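/- arXiv:2401.16707 — 2 statements merged into one kernel-verified Lean document; each statement's English description precedes it below -/
import Mathlib

section
/- Let 𝒳 and 𝒴 be finite alphabets, p_X a source distribution on 𝒳 and p_{Y|X} a channel such that the joint distribution satisfies p_{XY}(x,y) > 0 for all x ∈ 𝒳 and y ∈ 𝒴, and suppose p_{XY} is non-singular. Then the minimum average rate satisfies liminf_{n→∞} (R_n − I(X;Y)) / ((log₂ n)/n) ≥ 1/2; that is, a redundancy of (1/2)(log₂ n)/n is unavoidable for exact synthesis of a full-support non-singular discrete memoryless channel. -/
open MeasureTheory Filter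
open scoped BigOperators Classical

noncomputable section

/-- Binary strings `{0,1}*` carry the discrete σ-algebra. -/
instance : MeasurableSpace (List Bool) := ⊤

variable {𝒳 𝒴 : Type} [Fintype 𝒳] [Fintype 𝒴]

/-- The `n`-letter source pmf `p_{X^n}(x^n) = ∏ᵢ p_X(xᵢ)`. -/
def pXn (pX : 𝒳 → ℝ) (n : ℕ) (x : Fin n → 𝒳) : ℝ := ∏ i, pX (x i)

/-- The `n`-letter joint pmf `p_{X^nY^n}(x^n,y^n) = ∏ᵢ p_X(xᵢ) p_{Y|X}(yᵢ|xᵢ)`. -/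
def pJointn (pX : 𝒳 → ℝ) (pYX : 𝒳 → 𝒴 → ℝ) (n : ℕ)
    (x : Fin n → 𝒳) (y : Fin n → 𝒴) : ℝ :=
  ∏ i, pX (x i) * pYX (x i) (y i)

/-- Output marginal `p_Y(y) = ∑_x p_X(x) p_{Y|X}(y|x)`. -/
def pYm (pX : 𝒳 → ℝ) (pYX : 𝒳 → 𝒴 → ℝ) (y : 𝒴) : ℝ := ∑ x, pX x * pYX x y

/-- The mutual information `I(X;Y)` in bits of the single-letter joint distribution. -/
def mutInfo (pX : 𝒳 → ℝ) (pYX : 𝒳 → 𝒴 → ℝ) : ℝ :=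
  ∑ x, ∑ y, pX x * pYX x y * Real.logb 2 (pYX x y / pYm pX pYX y)

variable [MeasurableSpace 𝒴] [DiscreteMeasurableSpace 𝒴]

/-- The `n`-letter minimum average rate `R_n` of exact channel synthesis: the infimum of
`(1/n) E[ℓ(f(X^n,U))]` over all common randomness `(𝒰, μU)`, encoders `f` (measurable and
prefix-free for each `u`) and decoders `g` (measurable) such that, with `X^n ~ p_X^{⊗n}`
independent of `U` and `Y^n = g(f(X^n,U),U)`, the pair `(X^n,Y^n)` has the i.i.d. law
`(p_X p_{Y|X})^{⊗n}`. -/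
def Rn (pX : 𝒳 → ℝ) (pYX : 𝒳 → 𝒴 → ℝ) (n : ℕ) : ℝ :=
  sInf {r : ℝ |
    ∃ (𝒰 : Type) (_ : MeasurableSpace 𝒰) (μU : Measure 𝒰) (_ : IsProbabilityMeasure μU)
      (f : (Fin n → 𝒳) → 𝒰 → List Bool) (g : List Bool → 𝒰 → (Fin n → 𝒴)),
      (∀ x, Measurable fun u => f x u) ∧
      (∀ s, Measurable fun u => g s u) ∧
      (∀ (u : 𝒰) (x₁ x₂ : Fin n → 𝒳), (f x₁ u) <+: (f x₂ u) → f x₁ u = f x₂ u) ∧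
      (∀ (x : Fin n → 𝒳) (y : Fin n → 𝒴),
        pXn pX n x * (μU {u | g (f x u) u = y}).toReal = pJointn pX pYX n x y) ∧
      (∀ x, Integrable (fun u => ((f x u).length : ℝ)) μU) ∧
      r = (1 / n : ℝ) * ∑ x, pXn pX n x * ∫ u, ((f x u).length : ℝ) ∂μU}

/-- Singularity of a discrete joint distribution: all inputs that lead to a given output do
so with the same conditional likelihood. -/
def Singular (pX : 𝒳 → ℝ) (pYX : 𝒳 → 𝒴 → ℝ) : Prop :=
  ∀ (y : 𝒴) (x₁ x₂ : 𝒳), 0 < pX x₁ * pX x₂ →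
    0 < pYX x₁ y * pYX x₂ y → pYX x₁ y = pYX x₂ y

theorem uniquelyDecodable_of_prefixFree {α : Type*} {S : Set (List α)}
    (h : ∀ a ∈ S, ∀ b ∈ S, a <+: b → a = b) (h0 : [] ∉ S) :
    InformationTheory.UniquelyDecodable S := by
  intro L₁
  induction L₁ with
  | nil =>
    intro L₂ _ h₂ he
    cases L₂ with
    | nil => rfl
    | cons b L₂ =>
      simp only [List.flatten_nil, List.flatten_cons] at he
      have hb : b = [] := (List.append_eq_nil_iff.1 he.symm).1
      exact absurd (hb ▸ h₂ b (by simp)) h0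
  | cons a L₁ ih =>
    intro L₂ h₁ h₂ he
    cases L₂ with
    | nil =>
      simp only [List.flatten_nil, List.flatten_cons] at he
      have hb : a = [] := (List.append_eq_nil_iff.1 he).1
      exact absurd (hb ▸ h₁ a (by simp)) h0
    | cons b L₂ =>
      simp only [List.flatten_cons] at he
      have hab : a = b := by
        have ha : a <+: b ++ L₂.flatten := he ▸ List.prefix_append _ _
        rcases List.prefix_or_prefix_of_prefix ha (List.prefix_append b _) with hp | hp
        · exact h a (h₁ a (by simp)) b (h₂ b (by simp)) hp
        · exact (h b (h₂ b (by simp)) a (h₁ a (by simp)) hp).symm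
      subst hab
      rw [List.append_cancel_left_eq] at he
      rw [ih L₂ (fun w hw => h₁ w (by simp [hw])) (fun w hw => h₂ w (by simp [hw])) he]

theorem kraft_of_prefixFree {S : Finset (List Bool)}
    (h : ∀ a ∈ S, ∀ b ∈ S, a <+: b → a = b) :
    ∑ w ∈ S, (1 / 2 : ℝ) ^ w.length ≤ 1 := by
  by_cases h0 : [] ∈ S
  · have : S = {[]} := by
      ext a
      rw [Finset.mem_singleton]
      exact ⟨fun ha => (h [] h0 a ha List.nil_prefix).symm, fun ha => ha ▸ h0⟩
    simp [this]
  · have := InformationTheory.kraft_mcmillan_inequality (S := S)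
      (uniquelyDecodable_of_prefixFree (by simpa using h) (by simpa using h0))
    simpa using this

/-- The `P`-mass of the fibre of `φ` over `y`. -/
def fiberMass {α β : Type*} [Fintype α] (P : α → ℝ) (φ : α → β) (y : β) : ℝ :=
  ∑ x, if φ x = y then P x else 0

theorem le_fiberMass {α β : Type*} [Fintype α] {P : α → ℝ} (hP : ∀ x, 0 ≤ P x)
    (φ : α → β) (x : α) : P x ≤ fiberMass P φ (φ x) := by
  have := Finset.single_le_sum (f := fun x' => if φ x' = φ x then P x' else 0)
    (fun i _ => by split_ifs <;> simp [hP]) (Finset.mem_univ x)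
  simpa [fiberMass] using this

theorem fiberMass_le_fiberMass_comp {α β γ : Type*} [Fintype α] {P : α → ℝ}
    (hP : ∀ x, 0 ≤ P x) (c : α → β) (g : β → γ) (y : β) :
    fiberMass P c y ≤ fiberMass P (g ∘ c) (g y) := by
  refine Finset.sum_le_sum fun x _ => ?_
  by_cases h : c x = y
  · simp [h]
  · rw [if_neg h]; split_ifs <;> simp [hP]

/-- The expected length of a prefix-free code is at least the entropy of any function of the
codeword. -/
theorem entropy_le_expected_length {α β : Type*} [Fintype α] {P : α → ℝ}
    (hP : ∀ x, 0 < P x) (hP1 : ∑ x, P x = 1) (c : α → List Bool)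
    (hc : ∀ x₁ x₂, c x₁ <+: c x₂ → c x₁ = c x₂) (g : List Bool → β) :
    ∑ x, P x * (-Real.log (fiberMass P (g ∘ c) (g (c x)))) ≤
      Real.log 2 * ∑ x, P x * ((c x).length : ℝ) := by
  have hpos : ∀ x, 0 < fiberMass P c (c x) := fun x =>
    (hP x).trans_le (le_fiberMass (fun x => (hP x).le) c x)
  have hk : ∑ x, P x * ((1 / 2 : ℝ) ^ (c x).length / fiberMass P c (c x)) ≤ 1 := by
    rw [← Finset.sum_fiberwise_of_maps_to (g := c) (t := Finset.univ.image c) (by simp)]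
    refine le_trans (Finset.sum_le_sum (g := fun s => (1 / 2 : ℝ) ^ s.length) fun s hs => ?_)
      (kraft_of_prefixFree ?_)
    · have : ∀ x ∈ Finset.univ.filter (fun x => c x = s),
          P x * ((1 / 2 : ℝ) ^ (c x).length / fiberMass P c (c x)) =
          P x * ((1 / 2 : ℝ) ^ s.length / fiberMass P c s) := by
        intro x hx
        rw [(Finset.mem_filter.1 hx).2]
      rw [Finset.sum_congr rfl this, ← Finset.sum_mul, Finset.sum_filter]
      obtain ⟨x, -, rfl⟩ := Finset.mem_image.1 hs
      have := (hpos x).ne'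
      have hM : (∑ a, if c a = c x then P a else 0) = fiberMass P c (c x) :=
        Finset.sum_congr rfl fun _ _ => by congr
      rw [hM]
      field_simp
      rfl
    · intro a ha b hb hab
      obtain ⟨x, -, rfl⟩ := Finset.mem_image.1 ha
      obtain ⟨y, -, rfl⟩ := Finset.mem_image.1 hb
      exact hc x y hab
  have hterm : ∀ x, P x * (-Real.log (fiberMass P (g ∘ c) (g (c x)))) -
      Real.log 2 * (P x * ((c x).length : ℝ)) ≤
      P x * ((1 / 2 : ℝ) ^ (c x).length / fiberMass P c (c x)) - P x := by
    intro x
    have h1 : Real.log (fiberMass P c (c x)) ≤ Real.log (fiberMass P (g ∘ c) (g (c x))) :=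
      Real.log_le_log (hpos x) (fiberMass_le_fiberMass_comp (fun x => (hP x).le) c g _)
    have h2 := Real.log_le_sub_one_of_pos
      (show 0 < (1 / 2 : ℝ) ^ (c x).length / fiberMass P c (c x) by have := hpos x; positivity)
    rw [Real.log_div (by positivity) (hpos x).ne', Real.log_pow, one_div, Real.log_inv] at h2
    have := mul_le_mul_of_nonneg_left
      (show -Real.log (fiberMass P (g ∘ c) (g (c x))) - Real.log 2 * (c x).length ≤
        (1 / 2 : ℝ) ^ (c x).length / fiberMass P c (c x) - 1 by rw [one_div]; linarith)
      (hP x).le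
    linarith
  have := Finset.sum_le_sum fun x (_ : x ∈ Finset.univ) => hterm x
  rw [Finset.sum_sub_distrib, Finset.sum_sub_distrib, ← Finset.mul_sum, hP1] at this
  linarith

/-- Expectation over a random map `φ` with weights `w` and an independent input with weights
`P`. -/
def mapExp {α β : Type*} [Fintype α] [DecidableEq α] [Fintype β] (P : α → ℝ) (w : (α → β) → ℝ)
    (F : (α → β) → α → ℝ) : ℝ :=
  ∑ φ, ∑ x, w φ * P x * F φ x

section mapExp

variable {α β : Type*} [Fintype α] [DecidableEq α] [Fintype β] {P : α → ℝ} {w : (α → β) → ℝ}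
  {W : α → β → ℝ} {Q : β → ℝ}

theorem mapExp_mono (hP : ∀ x, 0 ≤ P x) (hw : ∀ φ, 0 ≤ w φ) {F G : (α → β) → α → ℝ}
    (h : ∀ φ x, F φ x ≤ G φ x) : mapExp P w F ≤ mapExp P w G :=
  Finset.sum_le_sum fun φ _ => Finset.sum_le_sum fun x _ =>
    mul_le_mul_of_nonneg_left (h φ x) (mul_nonneg (hw φ) (hP x))

theorem mapExp_add (F G : (α → β) → α → ℝ) :
    mapExp P w (fun φ x => F φ x + G φ x) = mapExp P w F + mapExp P w G := by
  simp only [mapExp, mul_add, Finset.sum_add_distrib]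

theorem mapExp_sub (F G : (α → β) → α → ℝ) :
    mapExp P w (fun φ x => F φ x - G φ x) = mapExp P w F - mapExp P w G := by
  simp only [mapExp, mul_sub, Finset.sum_sub_distrib]

theorem mapExp_const_mul (c : ℝ) (F : (α → β) → α → ℝ) :
    mapExp P w (fun φ x => c * F φ x) = c * mapExp P w F := by
  simp only [mapExp, Finset.mul_sum]
  exact Finset.sum_congr rfl fun _ _ => Finset.sum_congr rfl fun _ _ => by ring

variable [DecidableEq β]

theorem mapExp_eval (hsim : ∀ x y, ∑ φ, (if φ x = y then w φ else 0) = W x y)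
    (F : α → β → ℝ) :
    mapExp P w (fun φ x => F x (φ x)) = ∑ x, ∑ y, P x * W x y * F x y := by
  rw [mapExp, Finset.sum_comm]
  refine Finset.sum_congr rfl fun x _ => ?_
  simp only [← hsim, Finset.mul_sum, Finset.sum_mul]
  rw [Finset.sum_comm]
  refine Finset.sum_congr rfl fun φ _ => ?_
  simp only [mul_ite, ite_mul, mul_zero, zero_mul]
  rw [Finset.sum_ite_eq]
  simp only [Finset.mem_univ, if_true]
  ring

theorem mapExp_const (hP1 : ∑ x, P x = 1) (hW1 : ∀ x, ∑ y, W x y = 1)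
    (hsim : ∀ x y, ∑ φ, (if φ x = y then w φ else 0) = W x y) (c : ℝ) :
    mapExp P w (fun _ _ => c) = c := by
  have := mapExp_eval (P := P) hsim (fun _ _ => c)
  simpa [← Finset.sum_mul, ← Finset.mul_sum, hW1, hP1] using this

/-- Change of measure: weighting by the likelihood ratio `M W / Q` (with `M` the fibre mass)
decouples the input from the random map, given the output. -/
theorem mapExp_changeOfMeasure_le (hP : ∀ x, 0 < P x) (hW : ∀ x y, 0 < W x y)
    (hQ : ∀ y, 0 < Q y) (hw : ∀ φ, 0 ≤ w φ)
    (hsim : ∀ x y, ∑ φ, (if φ x = y then w φ else 0) = W x y)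
    (hQW : ∀ y, Q y = ∑ x, P x * W x y)
    (R : ℝ → ℝ) (hR : ∀ d, 0 ≤ R d) (T : (α → β) → β → ℝ) (h : α → β → ℝ) (G : β → ℝ)
    (hG : ∀ y t, ∑ x, P x * W x y / Q y * R (t - h x y) ≤ G y) :
    mapExp P w (fun φ x => fiberMass P φ (φ x) * (W x (φ x) / Q (φ x)) * R (T φ (φ x) - h x (φ x)))
      ≤ ∑ y, Q y * G y := by
  have hM : ∀ (φ : α → β) y, 0 ≤ fiberMass P φ y := fun φ y =>
    Finset.sum_nonneg fun x _ => by split_ifs <;> simp [(hP x).le]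
  have h1 : ∀ φ : α → β, ∑ x, w φ * P x *
      (fiberMass P φ (φ x) * (W x (φ x) / Q (φ x)) * R (T φ (φ x) - h x (φ x))) ≤
      ∑ y, w φ * fiberMass P φ y * G y := by
    intro φ
    calc _ ≤ ∑ x, ∑ y, w φ * fiberMass P φ y * (P x * W x y / Q y * R (T φ y - h x y)) := by
          refine Finset.sum_le_sum fun x _ => ?_
          refine le_trans (le_of_eq ?_) (Finset.single_le_sum (f := fun y =>
            w φ * fiberMass P φ y * (P x * W x y / Q y * R (T φ y - h x y)))
            (fun y _ => ?_) (Finset.mem_univ (φ x)))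
          · ring
          · have := hW x y; have := hP x; have := hQ y; have := hM φ y; have := hw φ
            have := hR (T φ y - h x y)
            positivity
      _ = ∑ y, w φ * fiberMass P φ y * ∑ x, P x * W x y / Q y * R (T φ y - h x y) := by
          rw [Finset.sum_comm]
          simp only [Finset.mul_sum]
      _ ≤ _ := Finset.sum_le_sum fun y _ =>
          mul_le_mul_of_nonneg_left (hG y _) (mul_nonneg (hw φ) (hM φ y))
  refine (Finset.sum_le_sum fun φ _ => h1 φ).trans (le_of_eq ?_)
  rw [Finset.sum_comm]
  refine Finset.sum_congr rfl fun y _ => ?_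
  rw [← Finset.sum_mul, hQW]
  congr 1
  simp only [← hsim, fiberMass, Finset.mul_sum]
  rw [Finset.sum_comm]
  exact Finset.sum_congr rfl fun x _ => Finset.sum_congr rfl fun φ _ => by
    split_ifs <;> ring

/-- One-shot converse: the gap `D` between the entropy of the simulated output given the common
randomness and the mutual information is large as soon as the information density is
anticoncentrated given the output. -/
theorem neg_log_le_of_anticoncentration (hP : ∀ x, 0 < P x) (hP1 : ∑ x, P x = 1)
    (hW : ∀ x y, 0 < W x y) (hW1 : ∀ x, ∑ y, W x y = 1)
    (hQ : ∀ y, 0 < Q y) (hw : ∀ φ, 0 ≤ w φ)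
    (hsim : ∀ x y, ∑ φ, (if φ x = y then w φ else 0) = W x y)
    (hQW : ∀ y, Q y = ∑ x, P x * W x y) (G : β → ℝ)
    (hG : ∀ y t, ∑ x, P x * W x y / Q y * (1 + (t - Real.log (W x y / Q y)) ^ 2)⁻¹ ≤ G y)
    {Γ D : ℝ} (hΓ : 0 < Γ) (hGΓ : ∑ y, Q y * G y ≤ Γ)
    (hD : mapExp P w (fun φ x => -Real.log (fiberMass P φ (φ x))) -
      ∑ x, ∑ y, P x * W x y * Real.log (W x y / Q y) ≤ D) :
    -2 ≤ D ∧ -Real.log Γ ≤ D + 2 * Real.log (3 + D) := by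
  set d : (α → β) → α → ℝ := fun φ x =>
    -Real.log (fiberMass P φ (φ x)) - Real.log (W x (φ x) / Q (φ x)) with hd
  have hM : ∀ (φ : α → β) x, 0 < fiberMass P φ (φ x) := fun φ x =>
    (hP x).trans_le (le_fiberMass (fun x => (hP x).le) φ x)
  have hexp : ∀ φ x, Real.exp (-d φ x) = fiberMass P φ (φ x) * (W x (φ x) / Q (φ x)) := by
    intro φ x
    have := div_pos (hW x (φ x)) (hQ (φ x))
    rw [hd, show -(-Real.log (fiberMass P φ (φ x)) - Real.log (W x (φ x) / Q (φ x))) =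
      Real.log (fiberMass P φ (φ x)) + Real.log (W x (φ x) / Q (φ x)) by ring,
      Real.exp_add, Real.exp_log (hM φ x), Real.exp_log this]
  have hQ1 : ∑ y, Q y = 1 := by
    simp only [hQW]
    rw [Finset.sum_comm]
    simp [← Finset.mul_sum, hW1, hP1]
  have hE0 : mapExp P w d ≤ D := by
    rw [hd, mapExp_sub, mapExp_eval hsim (fun x y => Real.log (W x y / Q y))]
    exact hD
  have hE1 : mapExp P w (fun φ x => Real.exp (-d φ x)) ≤ 1 := by
    have := mapExp_changeOfMeasure_le hP hW hQ hw hsim hQW (fun _ => 1) (by simp)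
      (fun _ _ => 0) (fun _ _ => 0) (fun _ => 1) (by
        intro y _
        simp only [mul_one, ← Finset.sum_div, ← hQW]
        rw [div_self (hQ y).ne'])
    simpa [hexp, hQ1] using this
  have hE2 : mapExp P w (fun φ x => Real.exp (-d φ x) * (1 + d φ x ^ 2)⁻¹) ≤ Γ := by
    have := mapExp_changeOfMeasure_le hP hW hQ hw hsim hQW (fun d => (1 + d ^ 2)⁻¹)
      (fun d => by positivity) (fun φ y => -Real.log (fiberMass P φ y))
      (fun x y => Real.log (W x y / Q y)) G hG
    simpa only [hexp] using this.trans hGΓ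
  have hconst := fun c => mapExp_const hP1 hW1 hsim c
  have habs : mapExp P w (fun φ x => |d φ x|) ≤ D + 2 := by
    have := mapExp_mono (fun x => (hP x).le) hw (F := fun φ x => |d φ x|)
      (G := fun φ x => d φ x + 2 * Real.exp (-d φ x)) (fun φ x => by
        have h1 := Real.add_one_le_exp (-d φ x)
        have h2 := Real.exp_pos (-d φ x)
        rw [abs_le]
        constructor <;> nlinarith)
    rw [mapExp_add, mapExp_const_mul] at this
    linarith
  have habs0 : 0 ≤ mapExp P w (fun φ x => |d φ x|) := by
    rw [← hconst 0]
    exact mapExp_mono (fun x => (hP x).le) hw fun φ x => abs_nonneg _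
  have hc : 0 < 3 + D := by linarith
  refine ⟨by linarith, ?_⟩
  have hpt : ∀ φ x, -d φ x ≤ 2 * (Real.log (3 + D) - 1 + (3 + D)⁻¹ * (1 + |d φ x|)) +
      (Γ⁻¹ * (Real.exp (-d φ x) * (1 + d φ x ^ 2)⁻¹) + (Real.log Γ - 1)) := by
    intro φ x
    have h1 : Real.log (1 + |d φ x|) ≤ Real.log (3 + D) - 1 + (3 + D)⁻¹ * (1 + |d φ x|) := by
      have h0 : 0 < 1 + |d φ x| := by positivity
      have := Real.log_le_sub_one_of_pos (div_pos h0 hc)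
      rw [Real.log_div h0.ne' hc.ne'] at this
      rw [div_eq_inv_mul] at this
      linarith
    have h2 : Real.log (1 + d φ x ^ 2) ≤ 2 * Real.log (1 + |d φ x|) := by
      rw [← Real.log_rpow (by positivity)]
      refine Real.log_le_log (by positivity) ?_
      have := abs_nonneg (d φ x)
      norm_cast
      nlinarith [sq_abs (d φ x)]
    have h3 : -d φ x - Real.log (1 + d φ x ^ 2) ≤
        Γ⁻¹ * (Real.exp (-d φ x) * (1 + d φ x ^ 2)⁻¹) + (Real.log Γ - 1) := by
      have h0 : 0 < Real.exp (-d φ x) * (1 + d φ x ^ 2)⁻¹ := by positivity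
      have := Real.log_le_sub_one_of_pos (div_pos h0 hΓ)
      rw [Real.log_div h0.ne' hΓ.ne', Real.log_mul (by positivity) (by positivity),
        Real.log_exp, Real.log_inv, div_eq_inv_mul] at this
      linarith
    linarith
  have := mapExp_mono (fun x => (hP x).le) hw (F := fun φ x => (-1) * d φ x)
    (fun φ x => by simpa using hpt φ x)
  rw [mapExp_add, mapExp_const_mul, mapExp_const_mul, mapExp_add, mapExp_add, mapExp_const_mul,
    mapExp_const_mul, mapExp_add, hconst, hconst, hconst] at this
  have h4 : (3 + D)⁻¹ * (1 + mapExp P w (fun φ x => |d φ x|)) ≤ 1 := by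
    rw [inv_mul_le_iff₀ hc]; linarith
  have h5 : Γ⁻¹ * mapExp P w (fun φ x => Real.exp (-d φ x) * (1 + d φ x ^ 2)⁻¹) ≤ 1 := by
    rw [inv_mul_le_iff₀ hΓ]; linarith
  linarith

end mapExp

theorem integral_exp_neg_mul_cos (a d : ℝ) :
    (1 + d ^ 2) * ∫ s in (0 : ℝ)..a, Real.exp (-s) * Real.cos (s * d) =
      Real.exp (-a) * (d * Real.sin (a * d) - Real.cos (a * d)) + 1 := by
  have hd : (1 + d ^ 2) ≠ 0 := by positivity
  have := intervalIntegral.integral_eq_sub_of_hasDerivAt (a := 0) (b := a)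
    (f := fun s => Real.exp (-s) * (d * Real.sin (s * d) - Real.cos (s * d)))
    (f' := fun s => (1 + d ^ 2) * (Real.exp (-s) * Real.cos (s * d))) (fun s _ => by
      have h1 : HasDerivAt (fun s : ℝ => Real.exp (-s)) (-Real.exp (-s)) s := by
        simpa using (hasDerivAt_neg s).exp
      have h0 : HasDerivAt (fun s : ℝ => s * d) d s := by simpa using (hasDerivAt_id s).mul_const d
      have h2 := (h0.sin.const_mul d).sub h0.cos
      have := h1.mul h2
      refine this.congr_deriv ?_
      simp only [Pi.sub_apply]
      ring) (Continuous.intervalIntegrable (by fun_prop) _ _)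
  rw [intervalIntegral.integral_const_mul] at this
  rw [this]
  simp

theorem mul_integral_cos_mul (a d : ℝ) :
    d * ∫ s in (0 : ℝ)..a, Real.cos (s * d) = Real.sin (a * d) := by
  have := intervalIntegral.integral_eq_sub_of_hasDerivAt (a := 0) (b := a)
    (f := fun s => Real.sin (s * d))
    (f' := fun s => d * Real.cos (s * d)) (fun s _ => by
      have h0 : HasDerivAt (fun s : ℝ => s * d) d s := by simpa using (hasDerivAt_id s).mul_const d
      exact h0.sin.congr_deriv (by ring)) (Continuous.intervalIntegrable (by fun_prop) _ _)
  rw [intervalIntegral.integral_const_mul] at this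
  rw [this]
  simp

theorem one_sub_exp_neg_mul_pos {a : ℝ} (ha : 0 < a) : 0 < 1 - Real.exp (-a) * (1 + a) := by
  have h := Real.add_one_lt_exp ha.ne'
  rw [Real.exp_neg, sub_pos, inv_mul_lt_iff₀ (Real.exp_pos a)]
  linarith

/-- A band-limited kernel dominating a multiple of the Cauchy kernel. -/
theorem cauchy_kernel_le_integral {a : ℝ} (ha : 0 < a) (d : ℝ) :
    (1 - Real.exp (-a) * (1 + a)) * (1 + d ^ 2)⁻¹ ≤
      ∫ s in (0 : ℝ)..a, (Real.exp (-s) - Real.exp (-a)) * Real.cos (s * d) := by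
  set S := ∫ s in (0 : ℝ)..a, Real.cos (s * d) with hS
  have hsplit : ∫ s in (0 : ℝ)..a, (Real.exp (-s) - Real.exp (-a)) * Real.cos (s * d) =
      (∫ s in (0 : ℝ)..a, Real.exp (-s) * Real.cos (s * d)) - Real.exp (-a) * S := by
    rw [hS, ← intervalIntegral.integral_const_mul, ← intervalIntegral.integral_sub]
    · simp only [sub_mul]
    · exact Continuous.intervalIntegrable (by fun_prop) _ _
    · exact Continuous.intervalIntegrable (by fun_prop) _ _
  have hSa : S ≤ a := by
    have := intervalIntegral.norm_integral_le_of_norm_le_const (a := 0) (b := a) (C := 1)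
      (f := fun s => Real.cos (s * d)) (fun s _ => Real.abs_cos_le_one _)
    have h2 := (le_abs_self S).trans this
    simpa [abs_of_pos ha] using h2
  have h1 := integral_exp_neg_mul_cos a d
  have h2 := mul_integral_cos_mul a d
  rw [← hS] at h2
  rw [← div_eq_mul_inv, div_le_iff₀ (by positivity), hsplit, sub_mul, mul_comm _ (1 + d ^ 2), h1,
    ← h2]
  have h3 := Real.cos_le_one (a * d)
  have h4 := Real.exp_pos (-a)
  nlinarith [mul_le_mul_of_nonneg_left (add_le_add h3 hSa) h4.le]

/-- The characteristic function of the weights `p` at the statistic `h`. -/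
def charSum {α : Type*} [Fintype α] (p h : α → ℝ) (s : ℝ) : ℂ :=
  ∑ x, (p x : ℂ) * Complex.exp ((s * h x : ℝ) * Complex.I)

theorem continuous_charSum {α : Type*} [Fintype α] (p h : α → ℝ) : Continuous (charSum p h) := by
  unfold charSum
  fun_prop

theorem norm_charSum_le {α : Type*} [Fintype α] {p : α → ℝ} (hp : ∀ x, 0 ≤ p x) (h : α → ℝ)
    (s : ℝ) : ‖charSum p h s‖ ≤ ∑ x, p x := by
  refine (norm_sum_le _ _).trans (Finset.sum_le_sum fun x _ => ?_)
  rw [norm_mul, Complex.norm_exp_ofReal_mul_I, mul_one, Complex.norm_real,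
    Real.norm_of_nonneg (hp x)]

theorem norm_exp_add_exp_le {u v : ℝ} (huv : |u - v| ≤ Real.pi) :
    ‖Complex.exp (u * Complex.I) + Complex.exp (v * Complex.I)‖ ≤
      2 - (u - v) ^ 2 / Real.pi ^ 2 := by
  have h : Complex.exp (u * Complex.I) + Complex.exp (v * Complex.I) =
      Complex.exp (((u + v) / 2 : ℝ) * Complex.I) * ((2 * Real.cos ((u - v) / 2) : ℝ) : ℂ) := by
    push_cast
    rw [Complex.cos, mul_div_cancel₀ _ two_ne_zero, mul_add, ← Complex.exp_add, ← Complex.exp_add]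
    congr 2 <;> ring
  have hab := abs_le.1 huv
  have hc : 0 ≤ Real.cos ((u - v) / 2) :=
    Real.cos_nonneg_of_neg_pi_div_two_le_of_le (by linarith) (by linarith)
  rw [h, norm_mul, Complex.norm_exp_ofReal_mul_I, one_mul, Complex.norm_real,
    Real.norm_of_nonneg (by positivity)]
  have := Real.cos_le_one_sub_mul_cos_sq (x := (u - v) / 2) (by
    rw [abs_le]; constructor <;> linarith [Real.pi_pos])
  have e : (u - v) ^ 2 / Real.pi ^ 2 = 2 * (2 / Real.pi ^ 2 * ((u - v) / 2) ^ 2) := by ring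
  linarith

theorem norm_charSum_le_one_sub {α : Type*} [Fintype α] {p : α → ℝ} (h : α → ℝ)
    (hp : ∀ x, 0 ≤ p x) (hp1 : ∑ x, p x = 1) {x₁ x₂ : α} (hne : x₁ ≠ x₂) {m : ℝ} (hm : 0 ≤ m)
    (h1 : m ≤ p x₁) (h2 : m ≤ p x₂) {s : ℝ} (hs : |s * (h x₁ - h x₂)| ≤ Real.pi) :
    ‖charSum p h s‖ ≤ 1 - m * (s * (h x₁ - h x₂)) ^ 2 / Real.pi ^ 2 := by
  set p' : α → ℝ := fun x => p x - (if x = x₁ then m else 0) - (if x = x₂ then m else 0) with hp'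
  have hp'0 : ∀ x, 0 ≤ p' x := by
    intro x
    simp only [hp']
    by_cases e1 : x = x₁
    · subst e1; simp [hne, h1]
    · by_cases e2 : x = x₂
      · subst e2; simp [e1, h2]
      · simp [e1, e2, hp x]
  have hp's : ∑ x, p' x = 1 - 2 * m := by
    simp only [hp', Finset.sum_sub_distrib, hp1, Finset.sum_ite_eq', Finset.mem_univ, if_true]
    ring
  have hsplit : charSum p h s = (m : ℂ) * (Complex.exp ((s * h x₁ : ℝ) * Complex.I) +
      Complex.exp ((s * h x₂ : ℝ) * Complex.I)) + charSum p' h s := by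
    have : ∀ x, (p x : ℂ) = (p' x : ℂ) + (if x = x₁ then (m : ℂ) else 0) +
        (if x = x₂ then (m : ℂ) else 0) := by
      intro x
      simp only [hp']
      split_ifs <;> push_cast <;> ring
    simp only [charSum, this, add_mul, Finset.sum_add_distrib, ite_mul, zero_mul,
      Finset.sum_ite_eq', Finset.mem_univ, if_true]
    ring
  have h3 := norm_exp_add_exp_le (u := s * h x₁) (v := s * h x₂) (by rwa [← mul_sub])
  have h4 := norm_charSum_le hp'0 h s
  rw [hsplit]
  refine (norm_add_le _ _).trans ?_
  rw [norm_mul, Complex.norm_real, Real.norm_of_nonneg hm]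
  have h5 := mul_le_mul_of_nonneg_left h3 hm
  rw [← mul_sub] at h5
  rw [hp's] at h4
  have e : m * (s * (h x₁ - h x₂)) ^ 2 / Real.pi ^ 2 =
    m * ((s * (h x₁ - h x₂)) ^ 2 / Real.pi ^ 2) := by ring
  linarith

theorem sum_prod_mul_cos_le {ι α : Type*} [Fintype ι] [DecidableEq ι] [Fintype α]
    (p h : ι → α → ℝ) (s t : ℝ) :
    ∑ x : ι → α, (∏ i, p i (x i)) * Real.cos (s * (t - ∑ i, h i (x i))) ≤
      ∏ i, ‖charSum (p i) (h i) s‖ := by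
  have hprod : ∏ i, charSum (p i) (h i) s = ∑ x : ι → α, ((∏ i, p i (x i) : ℝ) : ℂ) *
      Complex.exp ((s * ∑ i, h i (x i) : ℝ) * Complex.I) := by
    simp only [charSum]
    rw [Finset.prod_univ_sum]
    simp only [Fintype.piFinset_univ]
    refine Finset.sum_congr rfl fun x _ => ?_
    rw [Finset.prod_mul_distrib, ← Complex.exp_sum, ← Finset.sum_mul]
    push_cast
    rw [Finset.mul_sum]
  have hre : ∑ x : ι → α, (∏ i, p i (x i)) * Real.cos (s * (t - ∑ i, h i (x i))) =
      (Complex.exp ((-(s * t) : ℝ) * Complex.I) * ∏ i, charSum (p i) (h i) s).re := by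
    rw [hprod, Finset.mul_sum, Complex.re_sum]
    refine Finset.sum_congr rfl fun x _ => ?_
    rw [mul_left_comm, ← Complex.exp_add, ← add_mul, ← Complex.ofReal_add, Complex.re_ofReal_mul,
      Complex.exp_ofReal_mul_I_re, ← Real.cos_neg]
    congr 2
    ring
  rw [hre]
  refine (Complex.re_le_norm _).trans ?_
  rw [norm_mul, Complex.norm_exp_ofReal_mul_I, one_mul, norm_prod]

/-- Esseen-type concentration bound for the sum of independent statistics `h i`. -/
theorem sum_prod_mul_cauchy_le {ι α : Type*} [Fintype ι] [DecidableEq ι] [Fintype α] {p : ι → α → ℝ}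
    (h : ι → α → ℝ) (hp : ∀ i x, 0 ≤ p i x) {a : ℝ} (ha : 0 < a) (t : ℝ) :
    ∑ x : ι → α, (∏ i, p i (x i)) * (1 + (t - ∑ i, h i (x i)) ^ 2)⁻¹ ≤
      (1 - Real.exp (-a) * (1 + a))⁻¹ * ∫ s in (0 : ℝ)..a, ∏ i, ‖charSum (p i) (h i) s‖ := by
  have hc := one_sub_exp_neg_mul_pos ha
  rw [← mul_inv_le_iff₀' (by positivity), inv_inv, Finset.sum_mul]
  calc _ ≤ ∑ x : ι → α, ∫ s in (0 : ℝ)..a, (Real.exp (-s) - Real.exp (-a)) *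
        ((∏ i, p i (x i)) * Real.cos (s * (t - ∑ i, h i (x i)))) := by
        refine Finset.sum_le_sum fun x _ => ?_
        have := mul_le_mul_of_nonneg_left (cauchy_kernel_le_integral ha (t - ∑ i, h i (x i)))
          (Finset.prod_nonneg fun i (_ : i ∈ Finset.univ) => hp i (x i))
        rw [← intervalIntegral.integral_const_mul] at this
        refine le_trans (le_of_eq (by ring)) (this.trans (le_of_eq ?_))
        congr 1
        ext s
        ring
    _ = ∫ s in (0 : ℝ)..a, ∑ x : ι → α, (Real.exp (-s) - Real.exp (-a)) *
        ((∏ i, p i (x i)) * Real.cos (s * (t - ∑ i, h i (x i)))) := by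
        rw [intervalIntegral.integral_finsetSum]
        intro x _
        exact Continuous.intervalIntegrable (by fun_prop) _ _
    _ ≤ _ := by
        have hcont := fun i => continuous_charSum (p i) (h i)
        refine intervalIntegral.integral_mono_on ha.le
          (Continuous.intervalIntegrable (by fun_prop) _ _)
          (Continuous.intervalIntegrable (by fun_prop) _ _) fun s hs => ?_
        rw [← Finset.mul_sum]
        have h1 : Real.exp (-s) ≤ 1 := Real.exp_le_one_iff.2 (by linarith [hs.1])
        have h2 : Real.exp (-a) ≤ Real.exp (-s) := Real.exp_le_exp.2 (by linarith [hs.2])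
        have h3 : 0 ≤ ∏ i, ‖charSum (p i) (h i) s‖ := Finset.prod_nonneg fun i _ => norm_nonneg _
        refine (mul_le_mul_of_nonneg_left (sum_prod_mul_cos_le p h s t) (by linarith)).trans ?_
        exact mul_le_of_le_one_left h3 (by linarith [Real.exp_pos (-a)])

/-- If the statistic `h · b` is non-constant for some `b`, then its `n`-fold sum is spread out
over a scale of order `√n`, on average over the conditioning. -/
theorem exists_anticoncentration {α β : Type*} [Fintype α] [Fintype β] {q : β → ℝ}
    (hq : ∀ b, 0 < q b) (hq1 : ∑ b, q b = 1) {p : β → α → ℝ} (hp : ∀ b x, 0 < p b x)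
    (hp1 : ∀ b, ∑ x, p b x = 1) (h : β → α → ℝ) {b₀ : β} {x₁ x₂ : α}
    (hne : h b₀ x₁ ≠ h b₀ x₂) :
    ∃ C : ℝ, 0 < C ∧ ∀ n : ℕ, 0 < n → ∃ G : (Fin n → β) → ℝ,
      (∀ y t, ∑ x : Fin n → α, (∏ i, p (y i) (x i)) *
        (1 + (t - ∑ i, h (y i) (x i)) ^ 2)⁻¹ ≤ G y) ∧
      ∑ y, (∏ i, q (y i)) * G y ≤ C / √n := by
  set Δ := |h b₀ x₁ - h b₀ x₂| with hΔ
  have hΔ0 : 0 < Δ := abs_pos.2 (sub_ne_zero.2 hne)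
  set a := Real.pi / Δ with ha'
  have ha : 0 < a := div_pos Real.pi_pos hΔ0
  set m := min (p b₀ x₁) (p b₀ x₂)
  have hm : 0 < m := lt_min (hp _ _) (hp _ _)
  set k := q b₀ * (m * Δ ^ 2 / Real.pi ^ 2) with hk'
  have hk : 0 < k := by have := hq b₀; have := Real.pi_pos; positivity
  set c := (1 - Real.exp (-a) * (1 + a))⁻¹
  have hc : 0 < c := inv_pos.2 (one_sub_exp_neg_mul_pos ha)
  have hcont := fun b => continuous_charSum (p b) (h b)
  have hψ : ∀ s ∈ Set.Icc 0 a, ∑ b, q b * ‖charSum (p b) (h b) s‖ ≤ Real.exp (-k * s ^ 2) := by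
    intro s hs
    have hb₀ : ‖charSum (p b₀) (h b₀) s‖ ≤ 1 - m * (s * (h b₀ x₁ - h b₀ x₂)) ^ 2 / Real.pi ^ 2 := by
      refine norm_charSum_le_one_sub (h b₀) (fun x => (hp b₀ x).le) (hp1 b₀)
        (fun e => hne (by rw [e])) hm.le (min_le_left _ _) (min_le_right _ _) ?_
      rw [abs_mul, ← hΔ, abs_of_nonneg hs.1]
      exact (le_div_iff₀ hΔ0).1 hs.2
    rw [mul_pow, ← sq_abs (h b₀ x₁ - h b₀ x₂), ← hΔ] at hb₀
    have hb : ∀ b, q b * ‖charSum (p b) (h b) s‖ ≤ q b - if b = b₀ then k * s ^ 2 else 0 := by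
      intro b
      split_ifs with e
      · subst e
        refine (mul_le_mul_of_nonneg_left hb₀ (hq b).le).trans (le_of_eq ?_)
        rw [hk']; ring
      · have := norm_charSum_le (fun x => (hp b x).le) (h b) s
        rw [hp1] at this
        simpa using mul_le_mul_of_nonneg_left this (hq b).le
    refine (Finset.sum_le_sum fun b _ => hb b).trans ?_
    rw [Finset.sum_sub_distrib, hq1, Finset.sum_ite_eq']
    simp only [Finset.mem_univ, if_true]
    linarith [Real.add_one_le_exp (-k * s ^ 2)]
  refine ⟨c * (√(Real.pi / k) / 2), by have := Real.pi_pos; positivity, fun n hn =>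
    ⟨fun y => c * ∫ s in (0 : ℝ)..a, ∏ i, ‖charSum (p (y i)) (h (y i)) s‖, fun y t =>
      sum_prod_mul_cauchy_le (fun i => h (y i)) (fun i x => (hp (y i) x).le) ha t, ?_⟩⟩
  have hn' : (0 : ℝ) < n := by exact_mod_cast hn
  calc _ = c * ∫ s in (0 : ℝ)..a, (∑ b, q b * ‖charSum (p b) (h b) s‖) ^ n := by
        have : ∀ s, (∑ b, q b * ‖charSum (p b) (h b) s‖) ^ n =
            ∑ y : Fin n → β, (∏ i, q (y i)) * ∏ i, ‖charSum (p (y i)) (h (y i)) s‖ := by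
          intro s
          have := Finset.prod_univ_sum (fun _ : Fin n => (Finset.univ : Finset β))
            (fun _ b => q b * ‖charSum (p b) (h b) s‖)
          simp only [Finset.prod_const, Finset.card_univ, Fintype.card_fin,
            Fintype.piFinset_univ] at this
          rw [this]
          simp only [Finset.prod_mul_distrib]
        simp only [this]
        rw [intervalIntegral.integral_finsetSum fun y _ =>
          Continuous.intervalIntegrable (by fun_prop) _ _, Finset.mul_sum]
        refine Finset.sum_congr rfl fun y _ => ?_
        rw [intervalIntegral.integral_const_mul]
        ring
    _ ≤ c * ∫ s in (0 : ℝ)..a, Real.exp (-(k * n) * s ^ 2) := by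
        refine mul_le_mul_of_nonneg_left ?_ hc.le
        refine intervalIntegral.integral_mono_on ha.le
          (Continuous.intervalIntegrable (by fun_prop) _ _)
          (Continuous.intervalIntegrable (by fun_prop) _ _) fun s hs => ?_
        refine (pow_le_pow_left₀ (Finset.sum_nonneg fun b _ =>
          mul_nonneg (hq b).le (norm_nonneg _)) (hψ s hs) n).trans (le_of_eq ?_)
        rw [← Real.exp_nat_mul]
        congr 1
        ring
    _ ≤ c * ∫ s in Set.Ioi (0 : ℝ), Real.exp (-(k * n) * s ^ 2) := by
        refine mul_le_mul_of_nonneg_left ?_ hc.le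
        rw [intervalIntegral.integral_of_le ha.le]
        exact setIntegral_mono_set (integrable_exp_neg_mul_sq (by positivity)).integrableOn
          (Eventually.of_forall fun s => (Real.exp_pos _).le)
          (LE.le.eventuallyLE Set.Ioc_subset_Ioi_self)
    _ = _ := by
        rw [integral_gaussian_Ioi, ← div_div, Real.sqrt_div' _ hn'.le]
        ring

theorem sum_prod_eq_one {α : Type*} [Fintype α] {p : α → ℝ} (hp : ∑ a, p a = 1) (n : ℕ) :
    ∑ z : Fin n → α, ∏ i, p (z i) = 1 := by
  rw [← Fintype.sum_pow, hp, one_pow]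

theorem sum_prod_eq_prod_sum {α : Type*} [Fintype α] {n : ℕ} (p : Fin n → α → ℝ) :
    ∑ z : Fin n → α, ∏ i, p i (z i) = ∏ i, ∑ a, p i a := by
  rw [Finset.prod_univ_sum, Fintype.piFinset_univ]

theorem sum_prod_mul_sum {α : Type*} [Fintype α] {p : α → ℝ} (hp : ∑ a, p a = 1) (n : ℕ)
    (F : α → ℝ) :
    ∑ z : Fin n → α, (∏ i, p (z i)) * ∑ i, F (z i) = n * ∑ a, p a * F a := by
  have h : ∀ j : Fin n, ∑ z : Fin n → α, (∏ i, p (z i)) * F (z j) = ∑ a, p a * F a := by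
    intro j
    have h1 : ∀ z : Fin n → α, (∏ i, p (z i)) * F (z j) =
        ∏ i, p (z i) * (if i = j then F (z i) else 1) := by
      intro z
      rw [Finset.prod_mul_distrib, Finset.prod_ite_eq' Finset.univ j (fun i => F (z i))]
      simp
    simp only [h1]
    rw [sum_prod_eq_prod_sum (fun i a => p a * (if i = j then F a else 1)),
      Finset.prod_eq_single j]
    · simp
    · intro i _ hij
      simp [hij, hp]
    · simp
  simp only [Finset.mul_sum]
  rw [Finset.sum_comm]
  simp only [h, Finset.sum_const, Finset.card_univ, Fintype.card_fin, nsmul_eq_mul,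
    Finset.mul_sum]

theorem log_prod_div_prod {n : ℕ} {f g : Fin n → ℝ} (hf : ∀ i, 0 < f i) (hg : ∀ i, 0 < g i) :
    Real.log ((∏ i, f i) / ∏ i, g i) = ∑ i, Real.log (f i / g i) := by
  rw [← Finset.prod_div_distrib, Real.log_prod fun i _ => (div_pos (hf i) (hg i)).ne']

theorem prod_pYm {α β : Type} [Fintype α] {pX : α → ℝ} {pYX : α → β → ℝ} (n : ℕ)
    (y : Fin n → β) :
    ∏ i, pYm pX pYX (y i) = ∑ x, pXn pX n x * ∏ i, pYX (x i) (y i) := by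
  simp only [pYm, pXn, ← Finset.prod_mul_distrib]
  rw [sum_prod_eq_prod_sum (fun i a => pX a * pYX a (y i))]

theorem sum_pXn_mul_log_eq {α β : Type} [Fintype α] [Fintype β] {pX : α → ℝ}
    {pYX : α → β → ℝ} (hX1 : ∑ x, pX x = 1) (hY1 : ∀ x, ∑ y, pYX x y = 1)
    (hY : ∀ x y, 0 < pYX x y) (hm : ∀ y, 0 < pYm pX pYX y) (n : ℕ) :
    ∑ x : Fin n → α, ∑ y : Fin n → β, pXn pX n x * (∏ i, pYX (x i) (y i)) *
      Real.log ((∏ i, pYX (x i) (y i)) / ∏ i, pYm pX pYX (y i)) =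
      n * mutInfo pX pYX * Real.log 2 := by
  have h := sum_prod_mul_sum (p := fun z : α × β => pX z.1 * pYX z.1 z.2)
    (by simp [Fintype.sum_prod_type, ← Finset.mul_sum, hY1, hX1]) n
    (fun z => Real.log (pYX z.1 z.2 / pYm pX pYX z.2))
  rw [← (Equiv.arrowProdEquivProdArrow (Fin n) (fun _ => α) (fun _ => β)).symm.sum_comp,
    Fintype.sum_prod_type, Fintype.sum_prod_type] at h
  have hI : mutInfo pX pYX * Real.log 2 =
      ∑ x, ∑ y, pX x * pYX x y * Real.log (pYX x y / pYm pX pYX y) := by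
    have h2 : Real.log 2 ≠ 0 := (Real.log_pos one_lt_two).ne'
    simp only [mutInfo, Finset.sum_mul, Real.logb]
    refine Finset.sum_congr rfl fun x _ => Finset.sum_congr rfl fun y _ => ?_
    field_simp
  rw [mul_assoc, hI, ← h]
  refine Finset.sum_congr rfl fun x _ => Finset.sum_congr rfl fun y _ => ?_
  rw [log_prod_div_prod (fun i => hY _ _) (fun i => hm _), pXn, ← Finset.prod_mul_distrib]
  rfl

theorem integrable_comp_of_finite {Ω κ : Type*} [MeasurableSpace Ω] [Finite κ] {μ : Measure Ω}
    [IsFiniteMeasure μ] {Φ : Ω → κ} (hΦ : ∀ k, MeasurableSet {u | Φ u = k}) (H : κ → ℝ) :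
    Integrable (fun u => H (Φ u)) μ := by
  let _ : MeasurableSpace κ := ⊤
  have hm : Measurable Φ := measurable_to_countable' hΦ
  obtain ⟨C, hC⟩ := (Set.finite_range fun k => ‖H k‖).bddAbove
  exact Integrable.of_bound ((measurable_of_countable H).comp hm).aestronglyMeasurable C
    (Eventually.of_forall fun u => hC ⟨Φ u, rfl⟩)

theorem integral_comp_of_fintype {Ω κ : Type*} [MeasurableSpace Ω] [Fintype κ] {μ : Measure Ω}
    [IsFiniteMeasure μ] {Φ : Ω → κ} (hΦ : ∀ k, MeasurableSet {u | Φ u = k}) (H : κ → ℝ) :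
    ∫ u, H (Φ u) ∂μ = ∑ k, (μ {u | Φ u = k}).toReal * H k := by
  have h : ∀ u, H (Φ u) = ∑ k, Set.indicator {u | Φ u = k} (fun _ => H k) u := by
    intro u
    simp [Set.indicator_apply]
  simp only [h]
  rw [integral_finsetSum _ fun k _ => (integrable_const _).indicator (hΦ k)]
  refine Finset.sum_congr rfl fun k _ => ?_
  rw [integral_indicator_const _ (hΦ k)]
  rfl

theorem measurableSet_decode_eq {Ω γ : Type*} [MeasurableSpace Ω] [MeasurableSpace γ]
    [MeasurableSingletonClass γ] {f : Ω → List Bool} {g : List Bool → Ω → γ} (hf : Measurable f)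
    (hg : ∀ s, Measurable (g s)) (y : γ) : MeasurableSet {u | g (f u) u = y} := by
  have : {u | g (f u) u = y} = ⋃ s : List Bool, f ⁻¹' {s} ∩ g s ⁻¹' {y} := by
    ext u
    simp
  rw [this]
  exact MeasurableSet.iUnion fun s =>
    (hf MeasurableSpace.measurableSet_top).inter (hg s (measurableSet_singleton y))

section Rates

variable {α β : Type} [Fintype α] [Fintype β] [MeasurableSpace β] [DiscreteMeasurableSpace β]

/-- The set of average rates of exact `n`-letter simulation schemes. -/
def achievableRates (pX : α → ℝ) (pYX : α → β → ℝ) (n : ℕ) : Set ℝ :=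
  {r : ℝ |
    ∃ (𝒰 : Type) (_ : MeasurableSpace 𝒰) (μU : Measure 𝒰) (_ : IsProbabilityMeasure μU)
      (f : (Fin n → α) → 𝒰 → List Bool) (g : List Bool → 𝒰 → (Fin n → β)),
      (∀ x, Measurable fun u => f x u) ∧
      (∀ s, Measurable fun u => g s u) ∧
      (∀ (u : 𝒰) (x₁ x₂ : Fin n → α), (f x₁ u) <+: (f x₂ u) → f x₁ u = f x₂ u) ∧
      (∀ (x : Fin n → α) (y : Fin n → β),
        pXn pX n x * (μU {u | g (f x u) u = y}).toReal = pJointn pX pYX n x y) ∧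
      (∀ x, Integrable (fun u => ((f x u).length : ℝ)) μU) ∧
      r = (1 / n : ℝ) * ∑ x, pXn pX n x * ∫ u, ((f x u).length : ℝ) ∂μU}

/-- Every exact simulation scheme yields weights on deterministic maps that simulate the channel
and whose average output entropy is at most the expected length. -/
theorem exists_weights_of_mem_achievableRates {pX : α → ℝ} {pYX : α → β → ℝ}
    (hX : ∀ x, 0 < pX x) (hX1 : ∑ x, pX x = 1) {n : ℕ} (hn : 0 < n) {r : ℝ}
    (hr : r ∈ achievableRates pX pYX n) :
    ∃ w : ((Fin n → α) → Fin n → β) → ℝ, (∀ φ, 0 ≤ w φ) ∧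
      (∀ x y, ∑ φ, (if φ x = y then w φ else 0) = ∏ i, pYX (x i) (y i)) ∧
      mapExp (pXn pX n) w (fun φ x => -Real.log (fiberMass (pXn pX n) φ (φ x))) ≤
        n * r * Real.log 2 := by
  obtain ⟨𝒰, _, μ, _, f, g, hf, hg, hpre, hsim, hInt, rfl⟩ := hr
  have hP : ∀ x, 0 < pXn pX n x := fun x => Finset.prod_pos fun i _ => hX _
  have hP1 : ∑ x, pXn pX n x = 1 := sum_prod_eq_one hX1 n
  set Φ : 𝒰 → (Fin n → α) → Fin n → β := fun u x => g (f x u) u with hΦdef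
  have hΦ : ∀ φ, MeasurableSet {u | Φ u = φ} := by
    intro φ
    have : {u | Φ u = φ} = ⋂ x, {u | g (f x u) u = φ x} := by
      ext u
      simp [hΦdef, funext_iff]
    rw [this]
    exact MeasurableSet.iInter fun x => measurableSet_decode_eq (hf x) hg (φ x)
  refine ⟨fun φ => (μ {u | Φ u = φ}).toReal, fun φ => ENNReal.toReal_nonneg, ?_, ?_⟩
  · intro x y
    have h1 := integral_comp_of_fintype (μ := μ) hΦ (fun φ => if φ x = y then 1 else 0)
    have h2 : ∫ u, (if Φ u x = y then (1 : ℝ) else 0) ∂μ = (μ {u | g (f x u) u = y}).toReal := by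
      have := integral_indicator_const (μ := μ) (1 : ℝ) (measurableSet_decode_eq (hf x) hg y)
      rw [smul_eq_mul, mul_one] at this
      refine Eq.trans ?_ this
      refine integral_congr_ae (Eventually.of_forall fun u => ?_)
      simp [Set.indicator_apply, hΦdef]
    rw [h2] at h1
    simp only [mul_ite, mul_one, mul_zero] at h1
    rw [← h1]
    have h3 := hsim x y
    rw [pJointn, Finset.prod_mul_distrib] at h3
    exact mul_left_cancel₀ (hP x).ne' h3
  · have hn' : (n : ℝ) ≠ 0 := by exact_mod_cast hn.ne'
    set H : ((Fin n → α) → Fin n → β) → ℝ := fun φ =>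
      ∑ x, pXn pX n x * (-Real.log (fiberMass (pXn pX n) φ (φ x))) with hH
    have h1 : mapExp (pXn pX n) (fun φ => (μ {u | Φ u = φ}).toReal)
        (fun φ x => -Real.log (fiberMass (pXn pX n) φ (φ x))) = ∫ u, H (Φ u) ∂μ := by
      rw [integral_comp_of_fintype hΦ]
      simp only [mapExp, hH, Finset.mul_sum, mul_assoc]
    have h2 : (n : ℝ) * ((1 / n : ℝ) * ∑ x, pXn pX n x * ∫ u, ((f x u).length : ℝ) ∂μ) *
        Real.log 2 = ∫ u, Real.log 2 * ∑ x, pXn pX n x * ((f x u).length : ℝ) ∂μ := by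
      rw [integral_const_mul, integral_finsetSum _ fun x _ => (hInt x).const_mul _]
      simp only [integral_const_mul]
      field_simp
    rw [h1, h2]
    refine integral_mono (integrable_comp_of_finite hΦ H)
      ((integrable_finsetSum _ fun x _ => (hInt x).const_mul _).const_mul _) fun u => ?_
    exact entropy_le_expected_length hP hP1 (fun x => f x u) (hpre u) (fun s => g s u)

theorem exists_excess_bound {pX : α → ℝ} {pYX : α → β → ℝ}
    (hX : ∀ x, 0 < pX x) (hX1 : ∑ x, pX x = 1) (hY : ∀ x y, 0 < pYX x y)
    (hY1 : ∀ x, ∑ y, pYX x y = 1) (hns : ¬ Singular pX pYX) :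
    ∃ C : ℝ, 0 < C ∧ ∀ n : ℕ, 0 < n → ∀ r ∈ achievableRates pX pYX n, ∀ D : ℝ,
      D = n * (r - mutInfo pX pYX) * Real.log 2 →
      -2 ≤ D ∧ Real.log n / 2 - Real.log C ≤ D + 2 * Real.log (3 + D) := by
  simp only [Singular, not_forall] at hns
  obtain ⟨b₀, x₁, x₂, -, -, hne⟩ := hns
  have hm : ∀ y, 0 < pYm pX pYX y := fun y =>
    Finset.sum_pos (fun x _ => mul_pos (hX x) (hY x y)) ⟨x₁, Finset.mem_univ _⟩
  obtain ⟨C, hC, hCn⟩ := exists_anticoncentration (q := pYm pX pYX) hm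
    (by
      simp only [pYm]
      rw [Finset.sum_comm]
      simp [← Finset.mul_sum, hY1, hX1])
    (p := fun y x => pX x * pYX x y / pYm pX pYX y)
    (fun y x => div_pos (mul_pos (hX x) (hY x y)) (hm y))
    (fun y => by rw [← Finset.sum_div]; exact div_self (hm y).ne')
    (fun y x => Real.log (pYX x y / pYm pX pYX y)) (b₀ := b₀) (x₁ := x₁) (x₂ := x₂) (by
      intro h
      have := Real.log_injOn_pos (div_pos (hY _ _) (hm _)) (div_pos (hY _ _) (hm _)) h
      exact hne ((div_left_inj' (hm b₀).ne').1 this))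
  refine ⟨C, hC, fun n hn r hr D hD => ?_⟩
  obtain ⟨w, hw, hsim, hlen⟩ := exists_weights_of_mem_achievableRates hX hX1 hn hr
  obtain ⟨G, hG, hGC⟩ := hCn n hn
  have hn' : (0 : ℝ) < n := by exact_mod_cast hn
  have hP : ∀ x : Fin n → α, 0 < pXn pX n x := fun x => Finset.prod_pos fun i _ => hX _
  have key := neg_log_le_of_anticoncentration (P := pXn pX n)
    (W := fun x y => ∏ i, pYX (x i) (y i)) (Q := fun y => ∏ i, pYm pX pYX (y i)) (w := w)
    hP (sum_prod_eq_one hX1 n) (fun x y => Finset.prod_pos fun i _ => hY _ _)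
    (fun x => by
      rw [sum_prod_eq_prod_sum (fun i b => pYX (x i) b)]
      simp [hY1])
    (fun y => Finset.prod_pos fun i _ => hm _) hw
    hsim
    (prod_pYm n) G (fun y t => by
      refine le_trans (le_of_eq ?_) (hG y t)
      refine Finset.sum_congr rfl fun x _ => ?_
      rw [log_prod_div_prod (fun i => hY _ _) (fun i => hm _), Finset.prod_div_distrib,
        Finset.prod_mul_distrib, pXn])
    (Γ := C / √n) (D := D) (by positivity) hGC (by
      rw [sum_pXn_mul_log_eq hX1 hY1 hY hm, hD]
      linarith)
  rwa [Real.log_div hC.ne' (by positivity), Real.log_sqrt hn'.le, neg_sub] at key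

/-- Any rate below the optimal redundancy is eventually not achievable. -/
theorem eventually_le_redundancy {pX : α → ℝ} {pYX : α → β → ℝ}
    (hX : ∀ x, 0 < pX x) (hX1 : ∑ x, pX x = 1) (hY : ∀ x y, 0 < pYX x y)
    (hY1 : ∀ x, ∑ y, pYX x y = 1) (hns : ¬ Singular pX pYX) {a : ℝ} (ha0 : 0 < a)
    (ha : a < 1 / 2) :
    ∀ᶠ n : ℕ in atTop, ∀ r ∈ achievableRates pX pYX n,
      mutInfo pX pYX + a * (Real.logb 2 n / n) ≤ r := by
  obtain ⟨C, hC, hCn⟩ := exists_excess_bound hX hX1 hY hY1 hns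
  set ε := (1 / 2 - a) / 2 with hε
  have hε0 : 0 < ε := by rw [hε]; linarith
  have hlim : Tendsto (fun n : ℕ => ε * Real.log n) atTop atTop :=
    (Real.tendsto_log_atTop.comp tendsto_natCast_atTop_atTop).const_mul_atTop hε0
  filter_upwards [hlim.eventually_gt_atTop (Real.log C + 2 * (ε * 3 - 1 - Real.log ε)),
    eventually_gt_atTop 1] with n hbig hn1 r hr
  have hn' : (1 : ℝ) < n := by exact_mod_cast hn1
  have hL : 0 < Real.log n := Real.log_pos hn'
  have h2 : 0 < Real.log 2 := Real.log_pos one_lt_two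
  obtain ⟨hD2, hD⟩ := hCn n (by omega) r hr _ rfl
  set D := n * (r - mutInfo pX pYX) * Real.log 2 with hDdef
  have haD : a * Real.log n ≤ D := by
    by_contra! hlt
    have h3 : 0 < 3 + D := by linarith
    have h4 := Real.log_le_sub_one_of_pos (mul_pos hε0 h3)
    rw [Real.log_mul hε0.ne' h3.ne'] at h4
    have h5 : ε * D ≤ ε * (1 / 2 * Real.log n) :=
      mul_le_mul_of_nonneg_left (by nlinarith) hε0.le
    nlinarith
  have e : mutInfo pX pYX + a * (Real.logb 2 n / n) =
      mutInfo pX pYX + a * Real.log n / (n * Real.log 2) := by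
    rw [Real.logb]; field_simp
  have h6 : a * Real.log n / (n * Real.log 2) ≤ r - mutInfo pX pYX := by
    rw [div_le_iff₀ (by positivity)]
    linarith
  rw [e]
  linarith

end Rates

theorem prefix_append_of_length_eq {α : Type*} {a a' s s' : List α} (h : a.length = a'.length)
    (hp : a ++ s <+: a' ++ s') : a = a' ∧ s <+: s' := by
  obtain ⟨t, ht⟩ := hp
  rw [List.append_assoc] at ht
  obtain ⟨h1, h2⟩ := List.append_inj ht h
  exact ⟨h1, t, h2⟩

/-- The `L` lowest bits of `m`. -/
def fixedBits (L m : ℕ) : List Bool := List.ofFn fun i : Fin L => m.testBit i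

theorem length_fixedBits (L m : ℕ) : (fixedBits L m).length = L := List.length_ofFn

theorem fixedBits_inj {L m m' : ℕ} (hm : m < 2 ^ L) (hm' : m' < 2 ^ L)
    (h : fixedBits L m = fixedBits L m') : m = m' := by
  have h1 := List.ofFn_injective h
  refine Nat.eq_of_testBit_eq fun i => ?_
  by_cases hi : i < L
  · exact congrFun h1 ⟨i, hi⟩
  · have h2 : 2 ^ L ≤ 2 ^ i := Nat.pow_le_pow_right (by norm_num) (not_lt.1 hi)
    rw [Nat.testBit_lt_two_pow (hm.trans_le h2), Nat.testBit_lt_two_pow (hm'.trans_le h2)]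

/-- Unary code of `q`. -/
def unaryBits (q : ℕ) : List Bool := List.replicate q true ++ [false]

theorem unaryBits_prefixFree {q q' : ℕ} (h : unaryBits q <+: unaryBits q') : q = q' := by
  induction q generalizing q' with
  | zero =>
    cases q' with
    | zero => rfl
    | succ q' => simp [unaryBits, List.replicate_succ] at h
  | succ q ih =>
    cases q' with
    | zero => simp [unaryBits, List.replicate_succ] at h
    | succ q' =>
      simp only [unaryBits, List.replicate_succ, List.cons_append, List.cons_prefix_cons] at h
      rw [ih h.2]

/-- Golomb code of `k` with parameter `2 ^ b`, preceded by `b` written on `B` bits. -/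
def golomb (B b k : ℕ) : List Bool :=
  fixedBits B b ++ (fixedBits b (k % 2 ^ b) ++ unaryBits (k / 2 ^ b))

theorem length_golomb (B b k : ℕ) : (golomb B b k).length = B + (b + (k / 2 ^ b + 1)) := by
  simp [golomb, length_fixedBits, unaryBits]

theorem golomb_prefixFree {B b b' k k' : ℕ} (hb : b < 2 ^ B) (hb' : b' < 2 ^ B)
    (h : golomb B b k <+: golomb B b' k') : b = b' ∧ k = k' := by
  obtain ⟨h1, h2⟩ := prefix_append_of_length_eq (by simp [length_fixedBits]) h
  obtain rfl := fixedBits_inj hb hb' h1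
  obtain ⟨h3, h4⟩ := prefix_append_of_length_eq (by simp [length_fixedBits]) h2
  have h5 := fixedBits_inj (Nat.mod_lt _ (by positivity)) (Nat.mod_lt _ (by positivity)) h3
  have h6 := unaryBits_prefixFree h4
  refine ⟨rfl, ?_⟩
  rw [← Nat.div_add_mod k (2 ^ b), ← Nat.div_add_mod k' (2 ^ b), h5, h6]

/-- Decoder of the code `golomb B`. -/
def golombDecode (B : ℕ) (s : List Bool) : ℕ :=
  if h : ∃ b k, b < 2 ^ B ∧ golomb B b k = s then h.choose_spec.choose else 0

theorem golombDecode_golomb {B b : ℕ} (hb : b < 2 ^ B) (k : ℕ) :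
    golombDecode B (golomb B b k) = k := by
  have h : ∃ b' k', b' < 2 ^ B ∧ golomb B b' k' = golomb B b k := ⟨b, k, hb, rfl⟩
  rw [golombDecode, dif_pos h]
  obtain ⟨h1, h2⟩ := h.choose_spec.choose_spec
  exact (golomb_prefixFree h1 hb (by rw [h2])).2

/-- The first index at which the sequence `ω` is in `A` (`0` if there is none). -/
def firstHit {γ : Type*} (A : Set γ) (ω : ℕ → γ) : ℕ := sInf {j | ω j ∈ A}

theorem firstHit_eq_of_hit {γ : Type*} {A : Set γ} {ω : ℕ → γ} {j : ℕ} (hj : ω j ∈ A)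
    (h : ∀ i < j, ω i ∉ A) : firstHit A ω = j :=
  le_antisymm (Nat.sInf_le hj) (not_lt.1 fun hlt =>
    h _ hlt (Nat.sInf_mem (s := {j | ω j ∈ A}) ⟨j, hj⟩))

theorem notMem_of_lt_firstHit {γ : Type*} {A : Set γ} {ω : ℕ → γ} {i : ℕ}
    (h : i < firstHit A ω) : ω i ∉ A := fun hi => (Nat.sInf_le hi).not_gt h

section FirstHit

variable {γ : Type*} [MeasurableSpace γ] {A : Set γ}

theorem measurable_firstHit (hA : MeasurableSet A) : Measurable (firstHit A) := by
  have hm : ∀ i, MeasurableSet {ω : ℕ → γ | ω i ∈ A} := fun i => measurable_pi_apply i hA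
  have hn : ∀ i, MeasurableSet {ω : ℕ → γ | ω i ∉ A} := fun i => (hm i).compl
  refine measurable_to_countable' fun k => ?_
  have : firstHit A ⁻¹' {k} = ({ω | ω k ∈ A} ∩ ⋂ i, ⋂ _ : i < k, {ω | ω i ∉ A}) ∪
      ({_ω | k = 0} ∩ ⋂ i, {ω | ω i ∉ A}) := by
    ext ω
    simp only [Set.mem_preimage, Set.mem_singleton_iff, Set.mem_union, Set.mem_inter_iff,
      Set.mem_ofPred_eq, Set.mem_iInter]
    constructor
    · rintro rfl
      by_cases h : ∃ j, ω j ∈ A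
      · exact Or.inl ⟨Nat.sInf_mem h, fun i hi => notMem_of_lt_firstHit hi⟩
      · push Not at h
        refine Or.inr ⟨?_, h⟩
        have : {j | ω j ∈ A} = ∅ := by
          ext j
          simp [h j]
        simp [firstHit, this]
    · rintro (⟨h1, h2⟩ | ⟨rfl, h⟩)
      · exact firstHit_eq_of_hit h1 h2
      · have : {j | ω j ∈ A} = ∅ := by
          ext j
          simp [h j]
        simp [firstHit, this]
  rw [this]
  exact ((hm k).inter (MeasurableSet.iInter fun i => MeasurableSet.iInter fun _ => hn i)).union
    ((MeasurableSet.const _).inter (MeasurableSet.iInter hn))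

variable (ν : Measure γ) [IsProbabilityMeasure ν]

theorem infinitePi_forall_lt_notMem (hA : MeasurableSet A) (j : ℕ) :
    Measure.infinitePi (fun _ : ℕ => ν) {ω | ∀ i < j, ω i ∉ A} = (1 - ν A) ^ j := by
  have := Measure.infinitePi_pi (fun _ : ℕ => ν) (s := Finset.range j) (t := fun _ => Aᶜ)
    (fun _ _ => hA.compl)
  rw [Finset.prod_const, Finset.card_range, prob_compl_eq_one_sub hA] at this
  rw [← this]
  congr 1
  ext ω
  simp [Set.mem_pi]

theorem infinitePi_forall_lt_notMem_and_eq [MeasurableSingletonClass γ] (hA : MeasurableSet A)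
    (j : ℕ) (y : γ) :
    Measure.infinitePi (fun _ : ℕ => ν) {ω | (∀ i < j, ω i ∉ A) ∧ ω j = y} =
      (1 - ν A) ^ j * ν {y} := by
  have := Measure.infinitePi_pi (fun _ : ℕ => ν) (s := Finset.range (j + 1))
    (t := fun i => if i < j then Aᶜ else {y}) (fun i _ => by
      split_ifs
      exacts [hA.compl, measurableSet_singleton y])
  rw [Finset.prod_range_succ, if_neg (lt_irrefl j), Finset.prod_congr rfl (g := fun _ => ν Aᶜ)
    (fun i hi => by rw [if_pos (Finset.mem_range.1 hi)]), Finset.prod_const, Finset.card_range,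
    prob_compl_eq_one_sub hA] at this
  rw [← this]
  congr 1
  ext ω
  simp only [Set.mem_ofPred_eq, Set.mem_pi, Finset.coe_range, Set.mem_Iio]
  constructor
  · rintro ⟨h1, h2⟩ i hi
    split_ifs with h
    · exact h1 i h
    · obtain rfl : i = j := by omega
      exact h2
  · intro h
    refine ⟨fun i hi => ?_, ?_⟩
    · have := h i (by omega)
      rwa [if_pos hi] at this
    · have := h j (by omega)
      rwa [if_neg (lt_irrefl j)] at this

theorem le_infinitePi_firstHit_eq [MeasurableSingletonClass γ] (hA : MeasurableSet A) {y : γ}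
    (hy : y ∈ A) :
    (ν A)⁻¹ * ν {y} ≤ Measure.infinitePi (fun _ : ℕ => ν) {ω | ω (firstHit A ω) = y} := by
  set E : ℕ → Set (ℕ → γ) := fun j => {ω | (∀ i < j, ω i ∉ A) ∧ ω j = y} with hE
  have hfirst : ∀ {j ω}, ω ∈ E j → firstHit A ω = j := fun {j ω} h =>
    firstHit_eq_of_hit (h.2 ▸ hy) h.1
  have hmeas : ∀ j, MeasurableSet (E j) := by
    intro j
    have : E j = (⋂ i, ⋂ _ : i < j, {ω | ω i ∉ A}) ∩ {ω | ω j = y} := by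
      ext ω
      simp [hE]
    rw [this]
    exact (MeasurableSet.iInter fun i => MeasurableSet.iInter fun _ =>
      (measurable_pi_apply i hA).compl).inter
        ((measurable_pi_apply j : Measurable fun ω : ℕ → γ => ω j) (measurableSet_singleton y))
  have hdisj : Pairwise (Function.onFun Disjoint E) := fun j k hjk =>
    Set.disjoint_left.2 fun ω h1 h2 => hjk ((hfirst h1).symm.trans (hfirst h2))
  calc (ν A)⁻¹ * ν {y} = ∑' j, (1 - ν A) ^ j * ν {y} := by
        rw [ENNReal.tsum_mul_right, ENNReal.tsum_geometric,
          ENNReal.sub_sub_cancel ENNReal.one_ne_top prob_le_one]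
    _ = ∑' j, Measure.infinitePi (fun _ : ℕ => ν) (E j) := by
        simp only [hE, infinitePi_forall_lt_notMem_and_eq ν hA]
    _ = Measure.infinitePi (fun _ : ℕ => ν) (⋃ j, E j) := (measure_iUnion hdisj hmeas).symm
    _ ≤ _ := measure_mono (Set.iUnion_subset fun j ω h => by
        rw [Set.mem_ofPred_eq, hfirst h]
        exact h.2)

theorem lintegral_firstHit_le (hA : MeasurableSet A) :
    ∫⁻ ω, (firstHit A ω : ENNReal) ∂Measure.infinitePi (fun _ : ℕ => ν) ≤ (ν A)⁻¹ := by
  set E : ℕ → Set (ℕ → γ) := fun j => {ω | ∀ i < j, ω i ∉ A} with hE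
  have hmeas : ∀ j, MeasurableSet (E j) := by
    intro j
    have : E j = ⋂ i, ⋂ _ : i < j, {ω | ω i ∉ A} := by
      ext ω
      simp [hE]
    rw [this]
    exact MeasurableSet.iInter fun i => MeasurableSet.iInter fun _ =>
      (measurable_pi_apply i hA).compl
  have hle : ∀ ω, (firstHit A ω : ENNReal) ≤ ∑' j, (E j).indicator 1 ω := by
    intro ω
    refine le_trans ?_ (ENNReal.sum_le_tsum (Finset.range (firstHit A ω)))
    have : ∀ j ∈ Finset.range (firstHit A ω), (E j).indicator (1 : (ℕ → γ) → ENNReal) ω = 1 := by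
      intro j hj
      have hmem : ω ∈ E j := fun i hi =>
        notMem_of_lt_firstHit (hi.trans (Finset.mem_range.1 hj))
      simp [hmem]
    rw [Finset.sum_congr rfl this]
    simp
  refine (lintegral_mono hle).trans ?_
  rw [lintegral_tsum fun j => (measurable_one.indicator (hmeas j)).aemeasurable]
  have hE' : ∀ j, ∫⁻ ω, (E j).indicator 1 ω ∂Measure.infinitePi (fun _ : ℕ => ν) =
      (1 - ν A) ^ j := fun j => by
    rw [lintegral_indicator_one (hmeas j)]
    exact infinitePi_forall_lt_notMem ν hA j
  simp only [hE']
  rw [ENNReal.tsum_geometric, ENNReal.sub_sub_cancel ENNReal.one_ne_top prob_le_one]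

theorem integrable_firstHit (hA : MeasurableSet A) (h0 : ν A ≠ 0) :
    Integrable (fun ω => (firstHit A ω : ℝ)) (Measure.infinitePi (fun _ : ℕ => ν)) := by
  refine ⟨(measurable_from_top.comp (measurable_firstHit hA)).aestronglyMeasurable, ?_⟩
  rw [hasFiniteIntegral_iff_enorm]
  refine lt_of_le_of_lt (le_of_eq ?_) ((lintegral_firstHit_le ν hA).trans_lt
    (ENNReal.inv_lt_top.2 (pos_iff_ne_zero.2 h0)))
  refine lintegral_congr fun ω => ?_
  rw [Real.enorm_natCast]

theorem integral_firstHit_le (hA : MeasurableSet A) (h0 : ν A ≠ 0) :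
    ∫ ω, (firstHit A ω : ℝ) ∂Measure.infinitePi (fun _ : ℕ => ν) ≤ (ν.real A)⁻¹ := by
  rw [integral_eq_lintegral_of_nonneg_ae (Eventually.of_forall fun ω => Nat.cast_nonneg _)
    (measurable_from_top.comp (measurable_firstHit hA)).aestronglyMeasurable, Measure.real,
    ← ENNReal.toReal_inv]
  refine ENNReal.toReal_mono (ENNReal.inv_ne_top.2 h0) ?_
  simpa using lintegral_firstHit_le ν hA

end FirstHit

section WeightMeasure

variable {β : Type*} [Fintype β] [MeasurableSpace β]

/-- The measure on a finite type with point masses `p`. -/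
def weightMeasure (p : β → ℝ) : Measure β := ∑ y, ENNReal.ofReal (p y) • Measure.dirac y

theorem isProbabilityMeasure_weightMeasure {p : β → ℝ} (hp : ∀ y, 0 ≤ p y)
    (hp1 : ∑ y, p y = 1) : IsProbabilityMeasure (weightMeasure p) := by
  constructor
  simp [weightMeasure, Measure.finsetSum_apply, ← ENNReal.ofReal_sum_of_nonneg, hp, hp1]

variable [DiscreteMeasurableSpace β]

theorem weightMeasure_real {p : β → ℝ} (hp : ∀ y, 0 ≤ p y) (A : Set β) :
    (weightMeasure p).real A = ∑ y, if y ∈ A then p y else 0 := by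
  rw [Measure.real, weightMeasure, Measure.finsetSum_apply,
    ENNReal.toReal_sum fun y _ => by
      rw [Measure.smul_apply, smul_eq_mul]
      exact ENNReal.mul_ne_top ENNReal.ofReal_ne_top (measure_ne_top _ _)]
  refine Finset.sum_congr rfl fun y _ => ?_
  rw [Measure.smul_apply, Measure.dirac_apply' _ (MeasurableSet.of_discrete)]
  by_cases h : y ∈ A <;> simp [h, hp y]

theorem weightMeasure_real_singleton {p : β → ℝ} (hp : ∀ y, 0 ≤ p y) (y : β) :
    (weightMeasure p).real {y} = p y := by
  simp [weightMeasure_real hp]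

theorem weightMeasure_real_fiber {γ : Type*} {p : β → ℝ} (hp : ∀ y, 0 ≤ p y) (φ : β → γ) (z : γ) :
    (weightMeasure p).real {y | φ y = z} = fiberMass p φ z := by
  rw [weightMeasure_real hp, fiberMass]
  rfl

variable {Ω : Type*} [MeasurableSpace Ω] {ν : Measure Ω} [IsProbabilityMeasure ν]

theorem weightMeasure_prod_real {p : β → ℝ} (hp : ∀ y, 0 ≤ p y)
    [IsProbabilityMeasure (weightMeasure p)] {E : Set (β × Ω)} (hE : MeasurableSet E) :
    ((weightMeasure p).prod ν).real E = ∑ y, p y * ν.real (Prod.mk y ⁻¹' E) := by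
  rw [Measure.real, Measure.prod_apply hE, lintegral_fintype, ENNReal.toReal_sum fun y _ =>
    ENNReal.mul_ne_top (measure_ne_top _ _) (measure_ne_top _ _)]
  refine Finset.sum_congr rfl fun y _ => ?_
  rw [ENNReal.toReal_mul, mul_comm]
  exact congrArg (· * _) (weightMeasure_real_singleton hp y)

theorem integrable_weightMeasure_prod {p : β → ℝ}
    [IsProbabilityMeasure (weightMeasure p)] {F : β × Ω → ℝ} (hF : Measurable F)
    (hInt : ∀ y, Integrable (fun ω => F (y, ω)) ν) :
    Integrable F ((weightMeasure p).prod ν) :=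
  (integrable_prod_iff hF.aestronglyMeasurable).2
    ⟨Eventually.of_forall hInt, Integrable.of_finite⟩

theorem integral_weightMeasure_prod {p : β → ℝ} (hp : ∀ y, 0 ≤ p y)
    [IsProbabilityMeasure (weightMeasure p)] {F : β × Ω → ℝ} (hF : Measurable F)
    (hInt : ∀ y, Integrable (fun ω => F (y, ω)) ν) :
    ∫ z, F z ∂(weightMeasure p).prod ν = ∑ y, p y * ∫ ω, F (y, ω) ∂ν := by
  rw [integral_prod F (integrable_weightMeasure_prod hF hInt), integral_fintype .of_finite]
  simp only [weightMeasure_real_singleton hp, smul_eq_mul]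

end WeightMeasure

section OneShot

variable {α β ι : Type} [Fintype α] [Fintype β] [MeasurableSpace β] [DiscreteMeasurableSpace β]

theorem measurable_eval_firstHit (κ : β → ι) :
    Measurable fun z : β × (ℕ → β) => z.2 (firstHit {y' | κ y' = κ z.1} z.2) := by
  refine measurable_from_prod_countable_right fun y' => ?_
  have h1 : Measurable fun z : ℕ × (ℕ → β) => z.2 z.1 :=
    measurable_from_prod_countable_right fun k => measurable_pi_apply k
  exact h1.comp ((measurable_firstHit (A := {y'' | κ y'' = κ y'})
    MeasurableSet.of_discrete).prodMk measurable_id)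

/-- One step of layered rejection sampling: the first sample falling in the layer of a random
output has the right law. -/
theorem weightMeasure_prod_firstHit {w Q : β → ℝ} (hw : ∀ y, 0 ≤ w y) (hw1 : ∑ y, w y = 1)
    (hQ : ∀ y, 0 < Q y) (κ : β → ι) (hκ : ∀ y y', κ y = κ y' → w y * Q y' = w y' * Q y)
    [IsProbabilityMeasure (weightMeasure w)] [IsProbabilityMeasure (weightMeasure Q)] (y : β) :
    ((weightMeasure w).prod (Measure.infinitePi fun _ : ℕ => weightMeasure Q)).real
      {z | z.2 (firstHit {y' | κ y' = κ z.1} z.2) = y} = w y := by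
  set ν := Measure.infinitePi fun _ : ℕ => weightMeasure Q
  set h : β × (ℕ → β) → β := fun z => z.2 (firstHit {y' | κ y' = κ z.1} z.2) with hh
  have hmeas : Measurable h := measurable_eval_firstHit κ
  have hq : ∀ y, 0 < fiberMass Q κ (κ y) := fun y =>
    (hQ y).trans_le (le_fiberMass (fun y => (hQ y).le) κ y)
  have hle : ∀ y ∈ Finset.univ, w y ≤ ((weightMeasure w).prod ν).real (h ⁻¹' {y}) := by
    intro y _
    rw [weightMeasure_prod_real hw (hmeas (measurableSet_singleton y))]
    calc w y = ∑ y', if κ y' = κ y then w y' * (Q y / fiberMass Q κ (κ y)) else 0 := by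
          have h1 : ∀ y', (if κ y' = κ y then w y' * (Q y / fiberMass Q κ (κ y)) else 0) =
              w y / fiberMass Q κ (κ y) * (if κ y' = κ y then Q y' else 0) := by
            intro y'
            split_ifs with h2
            · rw [mul_div_assoc', hκ _ _ h2]
              ring
            · simp
          simp only [h1, ← Finset.mul_sum]
          exact (div_mul_cancel₀ _ (hq y).ne').symm
      _ ≤ _ := by
          refine Finset.sum_le_sum fun y' _ => ?_
          split_ifs with h2
          · refine mul_le_mul_of_nonneg_left ?_ (hw y')
            have h3 := le_infinitePi_firstHit_eq (weightMeasure Q) (A := {y'' | κ y'' = κ y'})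
              MeasurableSet.of_discrete (y := y) h2.symm
            have h4 := ENNReal.toReal_mono (measure_ne_top _ _) h3
            rw [ENNReal.toReal_mul, ENNReal.toReal_inv] at h4
            change ((weightMeasure Q).real _)⁻¹ * (weightMeasure Q).real _ ≤ _ at h4
            rw [weightMeasure_real_fiber (fun y => (hQ y).le),
              weightMeasure_real_singleton (fun y => (hQ y).le), h2, inv_mul_eq_div] at h4
            refine h4.trans_eq ?_
            simp only [hh, ← h2]
            rfl
          · exact mul_nonneg (hw y') measureReal_nonneg
  have hsum : ∑ y, w y = ∑ y, ((weightMeasure w).prod ν).real (h ⁻¹' {y}) := by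
    rw [hw1, sum_measureReal_preimage_singleton _ fun y _ => hmeas (measurableSet_singleton y)]
    simp
  exact ((Finset.sum_eq_sum_iff_of_le hle).1 hsum y (Finset.mem_univ y)).symm

/-- One-shot exact channel simulation by rejection sampling in layers `κ x` on which the likelihood
ratio is constant. -/
theorem exists_oneShot_simulation {W : α → β → ℝ} {Q : β → ℝ} (hW : ∀ x y, 0 ≤ W x y)
    (hW1 : ∀ x, ∑ y, W x y = 1) (hQ : ∀ y, 0 < Q y) (hQ1 : ∑ y, Q y = 1) (κ : α → β → ι)
    (hκ : ∀ x y y', κ x y = κ x y' → W x y * Q y' = W x y' * Q y) (B : ℕ)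
    (hB : ∀ y, Real.logb 2 (Q y)⁻¹ + 1 < 2 ^ B) :
    ∃ (𝒰 : Type) (_ : MeasurableSpace 𝒰) (μ : Measure 𝒰) (_ : IsProbabilityMeasure μ)
      (f : α → 𝒰 → List Bool) (g : List Bool → 𝒰 → β),
      (∀ x, Measurable fun u => f x u) ∧
      (∀ s, Measurable fun u => g s u) ∧
      (∀ (u : 𝒰) (x₁ x₂ : α), (f x₁ u) <+: (f x₂ u) → f x₁ u = f x₂ u) ∧
      (∀ x y, (μ {u | g (f x u) u = y}).toReal = W x y) ∧
      (∀ x, Integrable (fun u => ((f x u).length : ℝ)) μ) ∧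
      (∀ x, ∫ u, ((f x u).length : ℝ) ∂μ ≤
        B + 3 + ∑ y, W x y * Real.logb 2 (fiberMass Q (κ x) (κ x y))⁻¹) := by
  have hQ0 := fun y => (hQ y).le
  have hWp := fun x => isProbabilityMeasure_weightMeasure (hW x) (hW1 x)
  have hQp := isProbabilityMeasure_weightMeasure hQ0 hQ1
  set ν := Measure.infinitePi fun _ : ℕ => weightMeasure Q
  set q : α → β → ℝ := fun x y => fiberMass Q (κ x) (κ x y) with hq
  have hQq : ∀ x y, Q y ≤ q x y := fun x y => le_fiberMass hQ0 (κ x) y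
  have hq0 : ∀ x y, 0 < q x y := fun x y => (hQ y).trans_le (hQq x y)
  have hq1 : ∀ x y, q x y ≤ 1 := fun x y => by
    exact (weightMeasure_real_fiber hQ0 (κ x) (κ x y)).symm.trans_le measureReal_le_one
  have hlog : ∀ x y, 0 ≤ Real.logb 2 (q x y)⁻¹ := fun x y =>
    Real.logb_nonneg one_lt_two ((one_le_inv₀ (hq0 x y)).2 (hq1 x y))
  set b : α → β → ℕ := fun x y => ⌈Real.logb 2 (q x y)⁻¹⌉₊ with hb
  have hb_le : ∀ x y, (b x y : ℝ) ≤ Real.logb 2 (q x y)⁻¹ + 1 := fun x y =>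
    (Nat.ceil_lt_add_one (hlog x y)).le
  have hb_ge : ∀ x y, (q x y)⁻¹ ≤ 2 ^ b x y := fun x y => by
    have := (Real.logb_le_iff_le_rpow one_lt_two (inv_pos.2 (hq0 x y))).1
      (Nat.le_ceil (Real.logb 2 (q x y)⁻¹))
    exact_mod_cast this
  have hbB : ∀ x y, b x y < 2 ^ B := fun x y => by
    have h1 : Real.logb 2 (q x y)⁻¹ ≤ Real.logb 2 (Q y)⁻¹ :=
      Real.logb_le_logb_of_le one_lt_two (inv_pos.2 (hq0 x y))
        (inv_anti₀ (hQ y) (hQq x y))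
    have h2 := (hb_le x y).trans_lt ((add_le_add_left h1 1).trans_lt (hB y))
    exact_mod_cast h2
  set L : α → β → Set β := fun x y => {y' | κ x y' = κ x y} with hL
  set F : α → β × (ℕ → β) → List Bool := fun x z =>
    golomb B (b x z.1) (firstHit (L x z.1) z.2) with hF
  have hFm : ∀ x, Measurable (F x) := fun x =>
    measurable_from_prod_countable_right fun y =>
      (measurable_from_top (f := golomb B (b x y))).comp
        (measurable_firstHit (A := L x y) MeasurableSet.of_discrete)
  have hpres : ∀ x, MeasurePreserving (fun u : (α → β) × (ℕ → β) => (u.1 x, u.2))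
      ((Measure.pi fun x => weightMeasure (W x)).prod ν) ((weightMeasure (W x)).prod ν) :=
    fun x => (measurePreserving_eval _ x).prod (MeasurePreserving.id ν)
  have hlen : ∀ x, Measurable fun z => ((F x z).length : ℝ) := fun x =>
    (measurable_from_top (f := fun s : List Bool => (s.length : ℝ))).comp (hFm x)
  have hL0 : ∀ x y, (weightMeasure Q).real (L x y) = q x y := fun x y =>
    weightMeasure_real_fiber hQ0 (κ x) (κ x y)
  have hLne : ∀ x y, weightMeasure Q (L x y) ≠ 0 := fun x y h => by
    have := hL0 x y
    rw [Measure.real, h, ENNReal.toReal_zero] at this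
    exact (hq0 x y).ne this
  have hlen_le : ∀ x y ω, ((F x (y, ω)).length : ℝ) ≤
      B + b x y + 1 + (firstHit (L x y) ω : ℝ) / 2 ^ b x y := by
    intro x y ω
    have : ((firstHit (L x y) ω / 2 ^ b x y : ℕ) : ℝ) ≤
        (firstHit (L x y) ω : ℝ) / 2 ^ b x y := by
      exact_mod_cast Nat.cast_div_le (α := ℝ) (m := firstHit (L x y) ω) (n := 2 ^ b x y)
    simp only [hF, length_golomb]
    push_cast
    linarith
  have hbint : ∀ x y, Integrable
      (fun ω => (B + b x y + 1 : ℝ) + (firstHit (L x y) ω : ℝ) / 2 ^ b x y) ν := fun x y =>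
    (integrable_const _).add
      ((integrable_firstHit (weightMeasure Q) MeasurableSet.of_discrete (hLne x y)).div_const _)
  have hFint : ∀ x y, Integrable (fun ω => ((F x (y, ω)).length : ℝ)) ν := fun x y =>
    (hbint x y).mono' ((hlen x).comp measurable_prodMk_left).aestronglyMeasurable
      (Eventually.of_forall fun ω => by
        rw [Real.norm_natCast]
        exact hlen_le x y ω)
  have hFle : ∀ x y, ∫ ω, ((F x (y, ω)).length : ℝ) ∂ν ≤
      B + 3 + Real.logb 2 (q x y)⁻¹ := by
    intro x y
    refine (integral_mono (hFint x y) (hbint x y) fun ω => hlen_le x y ω).trans ?_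
    rw [integral_add (integrable_const _) ((integrable_firstHit (weightMeasure Q)
      MeasurableSet.of_discrete (hLne x y)).div_const _), integral_div, integral_const]
    have h1 := integral_firstHit_le (weightMeasure Q) MeasurableSet.of_discrete (hLne x y)
    rw [hL0] at h1
    have h2 : (∫ ω, (firstHit (L x y) ω : ℝ) ∂ν) / 2 ^ b x y ≤ 1 :=
      (div_le_one (by positivity)).2 (h1.trans (hb_ge x y))
    have h3 := hb_le x y
    simp only [probReal_univ, one_smul]
    linarith
  refine ⟨(α → β) × (ℕ → β), inferInstance, (Measure.pi fun x => weightMeasure (W x)).prod ν,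
    inferInstance, fun x u => F x (u.1 x, u.2), fun s u => u.2 (golombDecode B s),
    fun x => (hFm x).comp (hpres x).measurable,
    fun s => (measurable_pi_apply _).comp measurable_snd, ?_, ?_, ?_, ?_⟩
  · intro u x₁ x₂ h
    obtain ⟨h1, h2⟩ := golomb_prefixFree (hbB _ _) (hbB _ _) h
    simp only [hF, h1, h2]
  · intro x y
    have h1 := weightMeasure_prod_firstHit (hW x) (hW1 x) hQ (κ x) (hκ x) y
    rw [← h1]
    have h2 := (hpres x).measureReal_preimage
      (s := {z | z.2 (firstHit {y' | κ x y' = κ x z.1} z.2) = y})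
      (measurable_eval_firstHit (κ x) (measurableSet_singleton y)).nullMeasurableSet
    rw [← h2]
    simp only [hF, golombDecode_golomb (hbB _ _)]
    rfl
  · intro x
    exact (hpres x).integrable_comp_of_integrable
      (integrable_weightMeasure_prod (hlen x) (hFint x))
  · intro x
    have h1 : ∫ u, ((F x (u.1 x, u.2)).length : ℝ)
        ∂((Measure.pi fun x => weightMeasure (W x)).prod ν) =
        ∑ y, W x y * ∫ ω, ((F x (y, ω)).length : ℝ) ∂ν := by
      rw [← integral_weightMeasure_prod (hW x) (hlen x) (hFint x), ← (hpres x).map_eq,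
        integral_map (hpres x).measurable.aemeasurable (hlen x).aestronglyMeasurable]
    rw [h1]
    refine (Finset.sum_le_sum fun y _ =>
      mul_le_mul_of_nonneg_left (hFle x y) (hW x y)).trans_eq ?_
    simp only [mul_add, Finset.sum_add_distrib, ← Finset.sum_mul, hW1, one_mul]
    rfl

end OneShot

/-- The entropy of the image of `κ` is at most the logarithm of the number of its values. -/
theorem sum_mul_logb_fiberMass_le {β ι : Type*} [Fintype β] [Fintype ι] {w : β → ℝ}
    (hw : ∀ y, 0 < w y) (hw1 : ∑ y, w y = 1) (κ : β → ι) :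
    ∑ y, w y * Real.logb 2 (fiberMass w κ (κ y))⁻¹ ≤ Real.logb 2 (Fintype.card ι) := by
  have hp : ∀ y, 0 < fiberMass w κ (κ y) := fun y =>
    (hw y).trans_le (le_fiberMass (fun y => (hw y).le) κ y)
  have hne : Nonempty ι := by
    by_contra h
    have : IsEmpty β := ⟨fun y => h ⟨κ y⟩⟩
    simp at hw1
  have hc : (0 : ℝ) < Fintype.card ι := by exact_mod_cast Fintype.card_pos
  have h2 : 0 < Real.log 2 := Real.log_pos one_lt_two
  have hsum : ∑ y, w y * (fiberMass w κ (κ y))⁻¹ ≤ Fintype.card ι := by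
    rw [← Finset.sum_fiberwise Finset.univ κ, ← Finset.card_univ, Finset.cast_card]
    refine Finset.sum_le_sum fun k _ => ?_
    have h1 : ∀ y ∈ Finset.univ.filter (fun y => κ y = k),
        w y * (fiberMass w κ (κ y))⁻¹ = w y * (fiberMass w κ k)⁻¹ := fun y hy => by
      rw [(Finset.mem_filter.1 hy).2]
    rw [Finset.sum_congr rfl h1, ← Finset.sum_mul, Finset.sum_filter]
    have h3 : (∑ y, if κ y = k then w y else 0) = fiberMass w κ k :=
      Finset.sum_congr rfl fun _ _ => by congr
    rw [h3]
    exact mul_inv_le_one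
  have hpt : ∀ y, w y * Real.log (fiberMass w κ (κ y))⁻¹ ≤
      w y * (fiberMass w κ (κ y))⁻¹ / Fintype.card ι + w y * (Real.log (Fintype.card ι) - 1) := by
    intro y
    have := Real.log_le_sub_one_of_pos (div_pos (inv_pos.2 (hp y)) hc)
    rw [Real.log_div (inv_pos.2 (hp y)).ne' hc.ne'] at this
    rw [mul_div_assoc, ← mul_add]
    exact mul_le_mul_of_nonneg_left (by linarith) (hw y).le
  have h4 := Finset.sum_le_sum fun y (_ : y ∈ Finset.univ) => hpt y
  rw [Finset.sum_add_distrib, ← Finset.sum_div, ← Finset.sum_mul, hw1] at h4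
  have h5 := (div_le_one hc).2 hsum
  simp only [Real.logb, ← mul_div_assoc, ← Finset.sum_div]
  exact (div_le_div_iff_of_pos_right h2).2 (by linarith)

theorem sum_mul_logb_inv_fiberMass_le {β ι : Type*} [Fintype β] [Fintype ι] {w Q : β → ℝ}
    (hw : ∀ y, 0 < w y) (hw1 : ∑ y, w y = 1) (hQ : ∀ y, 0 < Q y) (κ : β → ι)
    (hκ : ∀ y y', κ y = κ y' → w y * Q y' = w y' * Q y) :
    ∑ y, w y * Real.logb 2 (fiberMass Q κ (κ y))⁻¹ ≤
      ∑ y, w y * Real.logb 2 (w y / Q y) + Real.logb 2 (Fintype.card ι) := by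
  refine le_trans (le_of_eq ?_) (add_le_add_right (sum_mul_logb_fiberMass_le hw hw1 κ) _)
  rw [← Finset.sum_add_distrib]
  refine Finset.sum_congr rfl fun y _ => ?_
  have hp : 0 < fiberMass w κ (κ y) :=
    (hw y).trans_le (le_fiberMass (fun y => (hw y).le) κ y)
  have hq : 0 < fiberMass Q κ (κ y) :=
    (hQ y).trans_le (le_fiberMass (fun y => (hQ y).le) κ y)
  have h1 : w y * fiberMass Q κ (κ y) = fiberMass w κ (κ y) * Q y := by
    rw [fiberMass, fiberMass, Finset.mul_sum, Finset.sum_mul]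
    refine Finset.sum_congr rfl fun y' _ => ?_
    split_ifs with h
    · exact hκ y y' h.symm
    · simp
  rw [← mul_add, ← Real.logb_mul (div_pos (hw y) (hQ y)).ne' (inv_pos.2 hp).ne']
  congr 2
  have := hQ y
  field_simp
  linarith

/-- The number of positions at which the pair of sequences `(x, y)` takes a given value. -/
def jointType {α β : Type*} {n : ℕ} (x : Fin n → α) (y : Fin n → β) (c : α × β) : Fin (n + 1) :=
  ⟨(Finset.univ.filter fun i => (x i, y i) = c).card,
    Nat.lt_succ_of_le ((Finset.card_le_univ _).trans_eq (Fintype.card_fin n))⟩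

theorem prod_eq_prod_pow_jointType {α β : Type*} [Fintype α] [Fintype β] {n : ℕ}
    (r : α × β → ℝ) (x : Fin n → α) (y : Fin n → β) :
    ∏ i, r (x i, y i) = ∏ c, r c ^ (jointType x y c : ℕ) := by
  rw [← Finset.prod_fiberwise Finset.univ fun i => (x i, y i)]
  refine Finset.prod_congr rfl fun c _ => ?_
  rw [Finset.prod_congr rfl (g := fun _ => r c) fun i hi => by rw [(Finset.mem_filter.1 hi).2],
    Finset.prod_const, jointType]

/-- Rates with logarithmic redundancy are achievable. -/
theorem exists_achievableRates_le {α β : Type} [Fintype α] [Fintype β] [MeasurableSpace β]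
    [DiscreteMeasurableSpace β] {pX : α → ℝ} {pYX : α → β → ℝ}
    (hX : ∀ x, 0 < pX x) (hX1 : ∑ x, pX x = 1) (hY : ∀ x y, 0 < pYX x y)
    (hY1 : ∀ x, ∑ y, pYX x y = 1) :
    ∃ C : ℝ, ∀ n : ℕ, 2 ≤ n →
      ∃ r ∈ achievableRates pX pYX n, r ≤ mutInfo pX pYX + C * (Real.logb 2 n / n) := by
  have hne : Nonempty α := by
    by_contra h
    rw [not_nonempty_iff] at h
    simp at hX1
  have hm : ∀ y, 0 < pYm pX pYX y := fun y =>
    Finset.sum_pos (fun x _ => mul_pos (hX x) (hY x y)) Finset.univ_nonempty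
  have hm1 : ∑ y, pYm pX pYX y = 1 := by
    simp only [pYm]
    rw [Finset.sum_comm]
    simp [← Finset.mul_sum, hY1, hX1]
  obtain ⟨m, hm0, hmle⟩ : ∃ m : ℕ, 0 < m ∧ ∀ y, Real.logb 2 (pYm pX pYX y)⁻¹ ≤ m := by
    obtain ⟨M, hM⟩ := (Set.finite_range fun y => Real.logb 2 (pYm pX pYX y)⁻¹).bddAbove
    obtain ⟨m, hm⟩ := exists_nat_ge M
    refine ⟨m + 1, m.succ_pos, fun y => ?_⟩
    have := hM ⟨y, rfl⟩
    push_cast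
    linarith
  set k := Fintype.card (α × β) with hk
  refine ⟨Real.logb 2 m + 6 + 2 * k, fun n hn => ?_⟩
  have hn0 : 0 < n := by omega
  have hn0' : (0 : ℝ) < n := by exact_mod_cast hn0
  have hL1 : 1 ≤ Real.logb 2 n := by
    rw [Real.le_logb_iff_rpow_le one_lt_two hn0', Real.rpow_one]
    exact_mod_cast hn
  have hlm : 0 ≤ Real.logb 2 m := Real.logb_nonneg one_lt_two (by exact_mod_cast hm0)
  set W : (Fin n → α) → (Fin n → β) → ℝ := fun x y => ∏ i, pYX (x i) (y i) with hWdef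
  set Q : (Fin n → β) → ℝ := fun y => ∏ i, pYm pX pYX (y i) with hQdef
  have hW : ∀ x y, 0 < W x y := fun x y => Finset.prod_pos fun i _ => hY _ _
  have hQ : ∀ y, 0 < Q y := fun y => Finset.prod_pos fun i _ => hm _
  have hW1 : ∀ x, ∑ y, W x y = 1 := fun x => by
    rw [hWdef, sum_prod_eq_prod_sum (fun i b => pYX (x i) b)]
    simp [hY1]
  have hκ : ∀ x y y', jointType x y = jointType x y' → W x y * Q y' = W x y' * Q y := by
    intro x y y' h
    have h1 : ∀ y, W x y / Q y =
        ∏ c : α × β, (pYX c.1 c.2 / pYm pX pYX c.2) ^ (jointType x y c : ℕ) := fun y => by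
      rw [← prod_eq_prod_pow_jointType, Finset.prod_div_distrib]
    have h2 : W x y / Q y = W x y' / Q y' := by rw [h1, h1, h]
    exact (div_eq_div_iff (hQ y).ne' (hQ y').ne').1 h2
  set B := Nat.log 2 (m * n + 1) + 1 with hB
  have hBlt : ∀ y, Real.logb 2 (Q y)⁻¹ + 1 < 2 ^ B := by
    intro y
    have h1 : Real.logb 2 (Q y)⁻¹ ≤ n * m := by
      rw [hQdef, ← Finset.prod_inv_distrib, Real.logb_prod _ _ fun i _ => (inv_pos.2 (hm _)).ne']
      refine (Finset.sum_le_sum fun i _ => hmle (y i)).trans_eq ?_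
      simp
    have h2 : m * n + 1 < 2 ^ B := Nat.lt_pow_succ_log_self one_lt_two _
    have h3 : ((m * n + 1 : ℕ) : ℝ) < 2 ^ B := by exact_mod_cast h2
    push_cast at h3
    linarith
  have hBle : (B : ℝ) ≤ Real.logb 2 m + Real.logb 2 n + 2 := by
    have h1 : ((Nat.log 2 (m * n + 1) : ℕ) : ℝ) ≤ Real.logb 2 ((m * n + 1 : ℕ) : ℝ) := by
      exact_mod_cast Real.natLog_le_logb (m * n + 1) 2
    have h2 : Real.logb 2 ((m * n + 1 : ℕ) : ℝ) ≤ Real.logb 2 (m * n * 2) := by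
      refine Real.logb_le_logb_of_le one_lt_two (by positivity) ?_
      have : 1 ≤ m * n := Nat.mul_pos hm0 hn0
      exact_mod_cast (by omega : m * n + 1 ≤ m * n * 2)
    have hm0' : (m : ℝ) ≠ 0 := by exact_mod_cast hm0.ne'
    rw [Real.logb_mul (by positivity) two_ne_zero, Real.logb_mul hm0' hn0'.ne',
      Real.logb_self_eq_one one_lt_two] at h2
    rw [hB]
    push_cast
    linarith
  obtain ⟨𝒰, i𝒰, μ, hμ, f, g, hf, hg, hpre, hsim, hInt, hlen⟩ := exists_oneShot_simulation
    (fun x y => (hW x y).le) hW1 hQ (sum_prod_eq_one hm1 n) jointType hκ B hBlt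
  refine ⟨_, ⟨𝒰, i𝒰, μ, hμ, f, g, hf, hg, hpre, fun x y => ?_, hInt, rfl⟩, ?_⟩
  · rw [hsim, pJointn, Finset.prod_mul_distrib, pXn]
  · have hcard : Real.logb 2 (Fintype.card (α × β → Fin (n + 1))) ≤ 2 * k * Real.logb 2 n := by
      rw [Fintype.card_fun, Fintype.card_fin, ← hk, Nat.cast_pow, Real.logb_pow]
      have h1 : Real.logb 2 ((n + 1 : ℕ) : ℝ) ≤ Real.logb 2 (n ^ 2) := by
        refine Real.logb_le_logb_of_le one_lt_two (by positivity) ?_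
        exact_mod_cast (by nlinarith : n + 1 ≤ n ^ 2)
      rw [Real.logb_pow] at h1
      have := mul_le_mul_of_nonneg_left h1 (Nat.cast_nonneg (α := ℝ) k)
      push_cast at this ⊢
      linarith
    have hbound : ∀ x, ∫ u, ((f x u).length : ℝ) ∂μ ≤
        ∑ y, W x y * Real.logb 2 (W x y / Q y) +
          (Real.logb 2 m + 6 + 2 * k) * Real.logb 2 n := by
      intro x
      have h1 := sum_mul_logb_inv_fiberMass_le (hW x) (hW1 x) hQ (jointType x) (hκ x)
      have h2 := hlen x
      nlinarith [mul_le_mul_of_nonneg_left hL1 hlm]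
    have hP : ∀ x, 0 < pXn pX n x := fun x => Finset.prod_pos fun i _ => hX _
    have hP1 : ∑ x, pXn pX n x = 1 := sum_prod_eq_one hX1 n
    have hmut : ∑ x, pXn pX n x * ∑ y, W x y * Real.logb 2 (W x y / Q y) =
        n * mutInfo pX pYX := by
      have h1 := sum_pXn_mul_log_eq hX1 hY1 hY hm n
      have h2 : Real.log 2 ≠ 0 := (Real.log_pos one_lt_two).ne'
      rw [← div_eq_iff h2] at h1
      rw [← h1]
      simp only [Finset.sum_div, Finset.mul_sum, Real.logb]
      exact Finset.sum_congr rfl fun x _ => Finset.sum_congr rfl fun y _ => by ring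
    have htot : ∑ x, pXn pX n x * ∫ u, ((f x u).length : ℝ) ∂μ ≤
        n * mutInfo pX pYX + (Real.logb 2 m + 6 + 2 * k) * Real.logb 2 n := by
      refine (Finset.sum_le_sum fun x _ =>
        mul_le_mul_of_nonneg_left (hbound x) (hP x).le).trans_eq ?_
      simp only [mul_add (pXn pX n _), Finset.sum_add_distrib, hmut, ← Finset.sum_mul, hP1,
        one_mul]
    rw [one_div, inv_mul_le_iff₀ hn0']
    refine htot.trans_eq ?_
    field_simp

/-- **Converse: optimal redundancy for full-support non-singular DMCs.**
Let `𝒳`, `𝒴` be finite alphabets, `p_X` a source and `p_{Y|X}` a channel whose joint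
distribution has full support (`p_{XY}(x,y) > 0` for all `x, y`) and is non-singular. Then
the minimum average rate of exact channel synthesis satisfies
`liminf_{n→∞} (R_n − I(X;Y)) / ((log₂ n)/n) ≥ 1/2`. -/
theorem redundancy_converse
    (pX : 𝒳 → ℝ) (pYX : 𝒳 → 𝒴 → ℝ)
    (hXnn : ∀ x, 0 ≤ pX x) (hXsum : ∑ x, pX x = 1)
    (hYXnn : ∀ x y, 0 ≤ pYX x y) (hYXsum : ∀ x, ∑ y, pYX x y = 1)
    (hfull : ∀ x y, 0 < pX x * pYX x y)
    (hnonsing : ¬ Singular pX pYX) :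
    (1 / 2 : ℝ) ≤
      atTop.liminf fun n : ℕ =>
        (Rn pX pYX n - mutInfo pX pYX) / (Real.logb 2 n / n) := by
  obtain ⟨x₀⟩ : Nonempty 𝒳 := by
    by_contra h
    rw [not_nonempty_iff] at h
    simp at hXsum
  obtain ⟨y₀⟩ : Nonempty 𝒴 := by
    by_contra h
    rw [not_nonempty_iff] at h
    simpa using hYXsum x₀
  have hX : ∀ x, 0 < pX x := fun x => pos_of_mul_pos_left (hfull x y₀) (hYXnn x y₀)
  have hY : ∀ x y, 0 < pYX x y := fun x y => pos_of_mul_pos_right (hfull x y) (hXnn x)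
  obtain ⟨C, hC⟩ := exists_achievableRates_le hX hXsum hY hYXsum
  have hlow := fun {a : ℝ} => eventually_le_redundancy (a := a) hX hXsum hY hYXsum hnonsing
  have hpos : ∀ {n : ℕ}, 2 ≤ n → 0 < Real.logb 2 n / n := fun {n} hn =>
    div_pos (Real.logb_pos one_lt_two (by exact_mod_cast hn)) (by positivity)
  have hbdd : IsBoundedUnder (· ≤ ·) atTop fun n : ℕ =>
      (Rn pX pYX n - mutInfo pX pYX) / (Real.logb 2 n / n) := by
    refine isBoundedUnder_of_eventually_le (a := C) ?_
    filter_upwards [hlow (a := 1 / 4) (by norm_num) (by norm_num), eventually_ge_atTop 2]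
      with n hn hn2
    obtain ⟨r, hr, hrC⟩ := hC n hn2
    have hRr : Rn pX pYX n ≤ r := csInf_le ⟨_, hn⟩ hr
    rw [div_le_iff₀ (hpos hn2)]
    linarith
  refine le_of_forall_lt fun a ha => ?_
  obtain ⟨b, hab, hb⟩ := exists_between (max_lt ha (by norm_num : (0 : ℝ) < 1 / 2))
  refine (max_lt_iff.1 hab).1.trans_le (le_liminf_of_le hbdd.isCoboundedUnder_ge ?_)
  filter_upwards [hlow (max_lt_iff.1 hab).2 hb, eventually_ge_atTop 2] with n hn hn2
  obtain ⟨r, hr, -⟩ := hC n hn2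
  have hRn : mutInfo pX pYX + b * (Real.logb 2 n / n) ≤ Rn pX pYX n := le_csInf ⟨r, hr⟩ hn
  rw [le_div_iff₀ (hpos hn2)]
  linarith

end
end

section
/- Let 𝒳 and 𝒴 be finite alphabets with a singular joint distribution p_{XY} = p_X p_{Y|X}, and fix Δ > 0 and n ≥ 1. Then the n-letter log-likelihood ratio log₂(p_{Y^n|X^n}(y^n|x^n)/p_{Y^n}(y^n)) is, on the support of p_{X^nY^n}, a function of y^n alone; hence Γ = Q_Δ(log₂(p_{Y^n|X^n}(Y^n|X^n)/p_{Y^n}(Y^n))) is a deterministic function of Y^n, and for every (x^n, y^n) with p_{X^nY^n}(x^n,y^n) > 0 and γ the corresponding value of Γ, p_{Y^n|X^n,Γ}(y^n|x^n,γ) / p_{Y^n|Γ}(y^n|γ) = (p_{Y^n|X^n}(y^n|x^n)/p_{Y^n}(y^n)) · (p_Γ(γ)/p_{Γ|X^n}(γ|x^n)) ≤ 2^{γ+Δ} · p_Γ(γ)/p_{Γ|X^n}(γ|x^n). -/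
open scoped BigOperators Classical

noncomputable section

variable {𝒳 𝒴 : Type} [Fintype 𝒳] [Fintype 𝒴]

/-- The uniform quantizer with step `Δ`, mapping each `x ∈ [jΔ, (j+1)Δ)` to the left
endpoint `jΔ`. -/
def qDelta (Δ x : ℝ) : ℝ := Δ * ⌊x / Δ⌋

/-- Output marginal `p_Y(y) = ∑_x p_X(x) p_{Y|X}(y|x)`. -/
def pY (pX : 𝒳 → ℝ) (pYX : 𝒳 → 𝒴 → ℝ) (y : 𝒴) : ℝ := ∑ x, pX x * pYX x y

/-- The `n`-letter channel `p_{Y^n|X^n}(y^n|x^n) = ∏ᵢ p_{Y|X}(yᵢ|xᵢ)`. -/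
def pYnXn (pYX : 𝒳 → 𝒴 → ℝ) (n : ℕ) (x : Fin n → 𝒳) (y : Fin n → 𝒴) : ℝ :=
  ∏ i, pYX (x i) (y i)

/-- The `n`-letter output marginal `p_{Y^n}(y^n) = ∏ᵢ p_Y(yᵢ)`. -/
def pYn (pX : 𝒳 → ℝ) (pYX : 𝒳 → 𝒴 → ℝ) (n : ℕ) (y : Fin n → 𝒴) : ℝ :=
  ∏ i, pY pX pYX (y i)

/-- The `n`-letter joint pmf `p_{X^nY^n}(x^n,y^n)`. -/
def pJn (pX : 𝒳 → ℝ) (pYX : 𝒳 → 𝒴 → ℝ) (n : ℕ) (x : Fin n → 𝒳) (y : Fin n → 𝒴) : ℝ :=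
  pXn pX n x * pYnXn pYX n x y

/-- The quantized `n`-letter log-likelihood ratio
`Γ(x^n,y^n) = Q_Δ(log₂(p_{Y^n|X^n}(y^n|x^n)/p_{Y^n}(y^n)))`. -/
def GammaVal (pX : 𝒳 → ℝ) (pYX : 𝒳 → 𝒴 → ℝ) (Δ : ℝ) (n : ℕ)
    (x : Fin n → 𝒳) (y : Fin n → 𝒴) : ℝ :=
  qDelta Δ (Real.logb 2 (pYnXn pYX n x y / pYn pX pYX n y))

/-- The pmf `p_Γ(γ)` of the quantized log-likelihood ratio. -/
def pGamma (pX : 𝒳 → ℝ) (pYX : 𝒳 → 𝒴 → ℝ) (Δ : ℝ) (n : ℕ) (γ : ℝ) : ℝ :=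
  ∑ x : Fin n → 𝒳, ∑ y : Fin n → 𝒴,
    if GammaVal pX pYX Δ n x y = γ then pJn pX pYX n x y else 0

/-- The conditional pmf `p_{Γ|X^n}(γ|x^n)`. -/
def pGammaXn (pX : 𝒳 → ℝ) (pYX : 𝒳 → 𝒴 → ℝ) (Δ : ℝ) (n : ℕ)
    (γ : ℝ) (x : Fin n → 𝒳) : ℝ :=
  (∑ y : Fin n → 𝒴, if GammaVal pX pYX Δ n x y = γ then pJn pX pYX n x y else 0) / pXn pX n x

/-- The conditional pmf `p_{Y^n|Γ}(y^n|γ)`. -/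
def pYnGamma (pX : 𝒳 → ℝ) (pYX : 𝒳 → 𝒴 → ℝ) (Δ : ℝ) (n : ℕ)
    (y : Fin n → 𝒴) (γ : ℝ) : ℝ :=
  (∑ x : Fin n → 𝒳, if GammaVal pX pYX Δ n x y = γ then pJn pX pYX n x y else 0) /
    pGamma pX pYX Δ n γ

/-- The conditional pmf `p_{Y^n|X^n,Γ}(y^n|x^n,γ)`. -/
def pYnXnGamma (pX : 𝒳 → ℝ) (pYX : 𝒳 → 𝒴 → ℝ) (Δ : ℝ) (n : ℕ)
    (y : Fin n → 𝒴) (x : Fin n → 𝒳) (γ : ℝ) : ℝ :=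
  (if GammaVal pX pYX Δ n x y = γ then pJn pX pYX n x y else 0) /
    ∑ y' : Fin n → 𝒴, if GammaVal pX pYX Δ n x y' = γ then pJn pX pYX n x y' else 0

theorem pX_pos_and_pYX_pos_of_pJn_pos {pX : 𝒳 → ℝ} {pYX : 𝒳 → 𝒴 → ℝ}
    (hXnn : ∀ x, 0 ≤ pX x) (hYXnn : ∀ x y, 0 ≤ pYX x y) {n : ℕ}
    {x : Fin n → 𝒳} {y : Fin n → 𝒴} (h : 0 < pJn pX pYX n x y) (i : Fin n) :
    0 < pX (x i) ∧ 0 < pYX (x i) (y i) := by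
  have hX : pXn pX n x ≠ 0 := left_ne_zero_of_mul h.ne'
  have hYX : pYnXn pYX n x y ≠ 0 := right_ne_zero_of_mul h.ne'
  exact ⟨(hXnn _).lt_of_ne' (Finset.prod_ne_zero_iff.1 hX i (Finset.mem_univ i)),
    (hYXnn _ _).lt_of_ne' (Finset.prod_ne_zero_iff.1 hYX i (Finset.mem_univ i))⟩

theorem pYnXn_eq_of_singular {pX : 𝒳 → ℝ} {pYX : 𝒳 → 𝒴 → ℝ}
    (hXnn : ∀ x, 0 ≤ pX x) (hYXnn : ∀ x y, 0 ≤ pYX x y) (hsing : Singular pX pYX) {n : ℕ}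
    {x₁ x₂ : Fin n → 𝒳} {y : Fin n → 𝒴}
    (h₁ : 0 < pJn pX pYX n x₁ y) (h₂ : 0 < pJn pX pYX n x₂ y) :
    pYnXn pYX n x₁ y = pYnXn pYX n x₂ y := by
  refine Finset.prod_congr rfl fun i _ => ?_
  have p₁ := pX_pos_and_pYX_pos_of_pJn_pos hXnn hYXnn h₁ i
  have p₂ := pX_pos_and_pYX_pos_of_pJn_pos hXnn hYXnn h₂ i
  exact hsing _ _ _ (mul_pos p₁.1 p₂.1) (mul_pos p₁.2 p₂.2)

theorem GammaVal_eq_of_singular {pX : 𝒳 → ℝ} {pYX : 𝒳 → 𝒴 → ℝ}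
    (hXnn : ∀ x, 0 ≤ pX x) (hYXnn : ∀ x y, 0 ≤ pYX x y) (hsing : Singular pX pYX)
    (Δ : ℝ) {n : ℕ} {x₁ x₂ : Fin n → 𝒳} {y : Fin n → 𝒴}
    (h₁ : 0 < pJn pX pYX n x₁ y) (h₂ : 0 < pJn pX pYX n x₂ y) :
    GammaVal pX pYX Δ n x₁ y = GammaVal pX pYX Δ n x₂ y := by
  rw [GammaVal, GammaVal, pYnXn_eq_of_singular hXnn hYXnn hsing h₁ h₂]

theorem pJn_nonneg {pX : 𝒳 → ℝ} {pYX : 𝒳 → 𝒴 → ℝ}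
    (hXnn : ∀ x, 0 ≤ pX x) (hYXnn : ∀ x y, 0 ≤ pYX x y) {n : ℕ}
    (x : Fin n → 𝒳) (y : Fin n → 𝒴) : 0 ≤ pJn pX pYX n x y :=
  mul_nonneg (Finset.prod_nonneg fun _ _ => hXnn _) (Finset.prod_nonneg fun _ _ => hYXnn _ _)

theorem sum_pJn_eq_pYn (pX : 𝒳 → ℝ) (pYX : 𝒳 → 𝒴 → ℝ) (n : ℕ) (y : Fin n → 𝒴) :
    ∑ x : Fin n → 𝒳, pJn pX pYX n x y = pYn pX pYX n y := by
  simp only [pJn, pXn, pYnXn, pYn, pY, ← Finset.prod_mul_distrib, Finset.prod_univ_sum,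
    Fintype.piFinset_univ]

theorem sum_GammaVal_fiber_eq_pYn {pX : 𝒳 → ℝ} {pYX : 𝒳 → 𝒴 → ℝ}
    (hXnn : ∀ x, 0 ≤ pX x) (hYXnn : ∀ x y, 0 ≤ pYX x y) (hsing : Singular pX pYX)
    (Δ : ℝ) {n : ℕ} {x : Fin n → 𝒳} {y : Fin n → 𝒴} (h : 0 < pJn pX pYX n x y) :
    (∑ x' : Fin n → 𝒳, if GammaVal pX pYX Δ n x' y = GammaVal pX pYX Δ n x y
      then pJn pX pYX n x' y else 0) = pYn pX pYX n y := by
  rw [← sum_pJn_eq_pYn]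
  refine Finset.sum_congr rfl fun x' _ => ?_
  rcases (pJn_nonneg hXnn hYXnn x' y).eq_or_lt with h0 | h'
  · rw [← h0, ite_self]
  · rw [if_pos (GammaVal_eq_of_singular hXnn hYXnn hsing Δ h' h)]

theorem lt_qDelta_add {Δ : ℝ} (hΔ : 0 < Δ) (t : ℝ) : t < qDelta Δ t + Δ := by
  have h := (div_lt_iff₀ hΔ).1 (Int.lt_floor_add_one (t / Δ))
  rw [qDelta]
  linarith

/-- **Likelihood-ratio ceiling for the primary scheme (singular channels).**
Let `𝒳`, `𝒴` be finite alphabets with a singular joint distribution `p_{XY} = p_X p_{Y|X}`,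
and fix `Δ > 0` and `n ≥ 1`. Then the `n`-letter log-likelihood ratio
`log₂(p_{Y^n|X^n}(y^n|x^n)/p_{Y^n}(y^n))` is, on the support of `p_{X^nY^n}`, a function of
`y^n` alone; hence `Γ = Q_Δ(LLR)` is a deterministic function of `Y^n`; and for every
`(x^n,y^n)` with `p_{X^nY^n}(x^n,y^n) > 0` and `γ` the corresponding value of `Γ`,
`p_{Y^n|X^n,Γ}(y^n|x^n,γ)/p_{Y^n|Γ}(y^n|γ)
   = (p_{Y^n|X^n}(y^n|x^n)/p_{Y^n}(y^n)) · (p_Γ(γ)/p_{Γ|X^n}(γ|x^n))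
   ≤ 2^{γ+Δ} · p_Γ(γ)/p_{Γ|X^n}(γ|x^n)`. -/
theorem lr_ceiling_singular
    (pX : 𝒳 → ℝ) (pYX : 𝒳 → 𝒴 → ℝ)
    (hXnn : ∀ x, 0 ≤ pX x) (hXsum : ∑ x, pX x = 1)
    (hYXnn : ∀ x y, 0 ≤ pYX x y) (hYXsum : ∀ x, ∑ y, pYX x y = 1)
    (hsing : Singular pX pYX)
    (Δ : ℝ) (hΔ : 0 < Δ) (n : ℕ) (hn : 1 ≤ n) :
    (∃ φ : (Fin n → 𝒴) → ℝ, ∀ (x : Fin n → 𝒳) (y : Fin n → 𝒴),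
        0 < pJn pX pYX n x y →
          Real.logb 2 (pYnXn pYX n x y / pYn pX pYX n y) = φ y) ∧
    (∃ ψ : (Fin n → 𝒴) → ℝ, ∀ (x : Fin n → 𝒳) (y : Fin n → 𝒴),
        0 < pJn pX pYX n x y → GammaVal pX pYX Δ n x y = ψ y) ∧
    (∀ (x : Fin n → 𝒳) (y : Fin n → 𝒴), 0 < pJn pX pYX n x y →
      pYnXnGamma pX pYX Δ n y x (GammaVal pX pYX Δ n x y) /
          pYnGamma pX pYX Δ n y (GammaVal pX pYX Δ n x y)
        = (pYnXn pYX n x y / pYn pX pYX n y) *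
            (pGamma pX pYX Δ n (GammaVal pX pYX Δ n x y) /
              pGammaXn pX pYX Δ n (GammaVal pX pYX Δ n x y) x) ∧
      pYnXnGamma pX pYX Δ n y x (GammaVal pX pYX Δ n x y) /
          pYnGamma pX pYX Δ n y (GammaVal pX pYX Δ n x y)
        ≤ (2 : ℝ) ^ (GammaVal pX pYX Δ n x y + Δ) *
            pGamma pX pYX Δ n (GammaVal pX pYX Δ n x y) /
              pGammaXn pX pYX Δ n (GammaVal pX pYX Δ n x y) x) := by
  have key : ∀ f : (Fin n → 𝒳) → (Fin n → 𝒴) → ℝ,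
      (∀ x₁ x₂ y, 0 < pJn pX pYX n x₁ y → 0 < pJn pX pYX n x₂ y → f x₁ y = f x₂ y) →
      ∃ φ : (Fin n → 𝒴) → ℝ, ∀ x y, 0 < pJn pX pYX n x y → f x y = φ y := by
    intro f hf
    refine ⟨fun y => if h : ∃ x, 0 < pJn pX pYX n x y then f h.choose y else 0, fun x y h => ?_⟩
    have hex : ∃ x, 0 < pJn pX pYX n x y := ⟨x, h⟩
    simp only [dif_pos hex]
    exact hf _ _ _ h hex.choose_spec
  refine ⟨key _ fun x₁ x₂ y h₁ h₂ => ?_,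
    key _ fun x₁ x₂ y h₁ h₂ => GammaVal_eq_of_singular hXnn hYXnn hsing Δ h₁ h₂,
    fun x y h => ?_⟩
  · rw [pYnXn_eq_of_singular hXnn hYXnn hsing h₁ h₂]
  have hW : 0 < pYnXn pYX n x y :=
    Finset.prod_pos fun i _ => (pX_pos_and_pYX_pos_of_pJn_pos hXnn hYXnn h i).2
  have hP : 0 < pXn pX n x :=
    Finset.prod_pos fun i _ => (pX_pos_and_pYX_pos_of_pJn_pos hXnn hYXnn h i).1
  have hY : 0 < pYn pX pYX n y := by
    rw [← sum_pJn_eq_pYn]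
    exact Finset.sum_pos' (fun x' _ => pJn_nonneg hXnn hYXnn x' y) ⟨x, Finset.mem_univ x, h⟩
  have hratio : pYnXn pYX n x y / pYn pX pYX n y ≤
      (2 : ℝ) ^ (GammaVal pX pYX Δ n x y + Δ) :=
    (Real.logb_le_iff_le_rpow one_lt_two (div_pos hW hY)).1 (lt_qDelta_add hΔ _).le
  have ite_nonneg : ∀ x' y', 0 ≤ if GammaVal pX pYX Δ n x' y' = GammaVal pX pYX Δ n x y
      then pJn pX pYX n x' y' else 0 := fun x' y' => by
    split_ifs
    exacts [pJn_nonneg hXnn hYXnn x' y', le_rfl]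
  have hG : 0 ≤ pGamma pX pYX Δ n (GammaVal pX pYX Δ n x y) :=
    Finset.sum_nonneg fun x' _ => Finset.sum_nonneg fun y' _ => ite_nonneg x' y'
  have hGX : 0 ≤ pGammaXn pX pYX Δ n (GammaVal pX pYX Δ n x y) x :=
    div_nonneg (Finset.sum_nonneg fun y' _ => ite_nonneg x y') hP.le
  have heq : pYnXnGamma pX pYX Δ n y x (GammaVal pX pYX Δ n x y) /
          pYnGamma pX pYX Δ n y (GammaVal pX pYX Δ n x y)
        = (pYnXn pYX n x y / pYn pX pYX n y) *
            (pGamma pX pYX Δ n (GammaVal pX pYX Δ n x y) /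
              pGammaXn pX pYX Δ n (GammaVal pX pYX Δ n x y) x) := by
    rw [pYnXnGamma, pYnGamma, pGammaXn, sum_GammaVal_fiber_eq_pYn hXnn hYXnn hsing Δ h,
      if_pos rfl, pJn, div_div_eq_mul_div, div_div_eq_mul_div]
    ring
  refine ⟨heq, ?_⟩
  rw [heq, mul_div_assoc]
  exact mul_le_mul_of_nonneg_right hratio (div_nonneg hG hGX)

end
end
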